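/- For every ε > 0 there exists a constant C = C(ε) > 0 with the following property. For every squarefree positive integer N, every positive divisor ℓ of N, every g ∈ SL₂(ℝ), every δ ∈ (0,1] and every L > 0, the set {(γ₁, γ₂) : γ₁, γ₂ ∈ R(ℓ;g) ∩ Ψ⋆(δ,L) and det(γ₁) = det(γ₂)} is finite and has cardinality at most C·(N(1+L))^ε · ℓL² · (1 + ℓ^{1/2}·H(g)·δ^{1/2} + (ℓ/N^{1/2})·L + ℓ·H(g)·δ^{1/2}·L + (ℓ²/N)·δ^{1/2}·L²)². -/

import Mathlib

open MeasureTheory Real Matrix Set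

noncomputable section

/-- 2×2 real matrices. -/
abbrev M2 := Matrix (Fin 2) (Fin 2) ℝ

/-- The lattice R(ℓ) = { (a, b; c, d) : a, d ∈ ℤ, b ∈ (1/ℓ)ℤ, c ∈ (N/ℓ)ℤ }. -/
def Rlat (N ℓ : ℕ) : Set M2 :=
  {γ | (∃ n : ℤ, γ 0 0 = (n : ℝ)) ∧ (∃ n : ℤ, γ 0 1 = (n : ℝ) / ℓ) ∧
       (∃ n : ℤ, γ 1 0 = (n : ℝ) * N / ℓ) ∧ (∃ n : ℤ, γ 1 1 = (n : ℝ))}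

/-- The conjugated lattice R(ℓ;g) = g⁻¹ · R(ℓ) · g. -/
def Rconj (N ℓ : ℕ) (g : M2) : Set M2 := {γ | g * γ * g⁻¹ ∈ Rlat N ℓ}

/-- P(γ): half the sum of the squares of the four entries of γ. -/
def Pfun (γ : M2) : ℝ := ((γ 0 0) ^ 2 + (γ 0 1) ^ 2 + (γ 1 0) ^ 2 + (γ 1 1) ^ 2) / 2

/-- Ω(δ,L) = {γ : P(γ) ≤ L² and P(γ) − det γ ≤ 2δL²}. -/
def OmegaSet (δ L : ℝ) : Set M2 := {γ | Pfun γ ≤ L ^ 2 ∧ Pfun γ - γ.det ≤ 2 * δ * L ^ 2}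

/-- Ω⋆(δ,L): nonzero elements of Ω(δ,L). -/
def OmegaStar (δ L : ℝ) : Set M2 := {γ | γ ∈ OmegaSet δ L ∧ γ ≠ 0}

/-- Ψ(δ,L) = {γ : P(γ) ≤ L² and P(γ) + det γ ≤ 2δL²}. -/
def PsiSet (δ L : ℝ) : Set M2 := {γ | Pfun γ ≤ L ^ 2 ∧ Pfun γ + γ.det ≤ 2 * δ * L ^ 2}

/-- Ψ⋆(δ,L): nonzero elements of Ψ(δ,L). -/
def PsiStar (δ L : ℝ) : Set M2 := {γ | γ ∈ PsiSet δ L ∧ γ ≠ 0}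

/-- Möbius action of a 2×2 real matrix on a complex number. -/
def moebius (m : M2) (z : ℂ) : ℂ :=
  ((m 0 0 : ℂ) * z + (m 0 1 : ℂ)) / ((m 1 0 : ℂ) * z + (m 1 1 : ℂ))

/-- A₀(N): determinant-one matrices of the form Q^{−1/2}·(Qa, b; Nc, Qd)
    with Q a positive divisor of N and a,b,c,d ∈ ℤ. -/
def AtkinLehner (N : ℕ) : Set M2 :=
  {σ | σ.det = 1 ∧ ∃ (Q : ℕ) (a b c d : ℤ), 0 < Q ∧ Q ∣ N ∧
     σ = (Real.sqrt Q)⁻¹ • !![(Q : ℝ) * a, (b : ℝ); (N : ℝ) * c, (Q : ℝ) * d]}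

/-- H(g) = sup_{σ ∈ A₀(N)} Im(σ·(g·i)). -/
def Hgt (N : ℕ) (g : M2) : ℝ :=
  sSup ((fun σ => (moebius σ (moebius g Complex.I)).im) '' AtkinLehner N)

theorem div_bound (ε : ℝ) (hε : 0 < ε) : ∃ C : ℝ, 1 ≤ C ∧ ∀ n : ℕ, 0 < n →
    ((Nat.divisors n).card : ℝ) ≤ C * (n : ℝ) ^ ε := by
  set K : ℝ := max 1 (1 / (ε * Real.log 2)) with hK
  set B : ℕ := ⌈(2:ℝ) ^ (1/ε)⌉₊ with hB
  have hK1 : 1 ≤ K := le_max_left _ _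
  have hl2 : 0 < Real.log 2 := Real.log_pos (by norm_num)
  have hel : 0 < ε * Real.log 2 := by positivity
  refine ⟨K ^ B, one_le_pow₀ hK1, ?_⟩
  intro n hn
  rw [Nat.card_divisors hn.ne']
  have hfac : (n : ℝ) ^ ε = ∏ p ∈ n.primeFactors, ((p : ℝ) ^ (n.factorization p)) ^ ε := by
    rw [Real.finsetProd_rpow _ _ (fun i _ => by positivity)]
    congr 1
    conv_lhs => rw [← Nat.prod_factorization_pow_eq_self hn.ne']
    simp [Finsupp.prod, Nat.support_factorization]
  have key : ∀ p ∈ n.primeFactors, ((n.factorization p + 1 : ℕ) : ℝ) ≤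
      (if p < B then K else 1) * ((p : ℝ) ^ (n.factorization p)) ^ ε := by
    intro p hp
    have hp2 : 2 ≤ p := (Nat.prime_of_mem_primeFactors hp).two_le
    have hp2' : (2:ℝ) ≤ p := by exact_mod_cast hp2
    set v := n.factorization p
    have e1 : ((p : ℝ) ^ v) ^ ε = ((p:ℝ) ^ ε) ^ v := by
      rw [← Real.rpow_natCast, ← Real.rpow_mul (by positivity), mul_comm, Real.rpow_mul (by positivity), Real.rpow_natCast]
    split_ifs with h
    · have h2 : ((2:ℝ) ^ v) ^ ε ≤ ((p : ℝ) ^ v) ^ ε := by gcongr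
      have h3 : 1 + v * (ε * Real.log 2) ≤ ((2:ℝ) ^ v) ^ ε := by
        have : ((2:ℝ) ^ v) ^ ε = Real.exp (v * (ε * Real.log 2)) := by
          rw [← Real.rpow_natCast, ← Real.rpow_mul (by positivity), Real.rpow_def_of_pos (by norm_num)]
          congr 1; ring
        rw [this]
        linarith [Real.add_one_le_exp (v * (ε * Real.log 2))]
      have h4 : (v : ℝ) + 1 ≤ K * (1 + v * (ε * Real.log 2)) := by
        have : 1 ≤ K * (ε * Real.log 2) := by
          have : 1 / (ε * Real.log 2) ≤ K := le_max_right _ _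
          rwa [div_le_iff₀ hel] at this
        have hv : (0:ℝ) ≤ v := by positivity
        nlinarith
      push_cast
      calc (v : ℝ) + 1 ≤ K * (1 + v * (ε * Real.log 2)) := h4
        _ ≤ K * ((p : ℝ) ^ v) ^ ε := by
          apply mul_le_mul_of_nonneg_left (h3.trans h2) (by linarith)
    · rw [one_mul, e1]
      have hpB : (2:ℝ) ^ (1/ε) ≤ p := by
        have : (B : ℝ) ≤ p := by exact_mod_cast not_lt.mp h
        exact (Nat.le_ceil _).trans this
      have : (2:ℝ) ≤ (p:ℝ) ^ ε := by
        calc (2:ℝ) = ((2:ℝ) ^ (1/ε)) ^ ε := by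
              rw [← Real.rpow_mul (by norm_num)]; field_simp; simp
          _ ≤ _ := by gcongr
      have h5 : (2:ℝ) ^ v ≤ ((p:ℝ) ^ ε) ^ v := by gcongr
      refine le_trans ?_ h5
      exact_mod_cast (Nat.lt_two_pow_self (n := v))
  calc ((∏ x ∈ n.primeFactors, (n.factorization x + 1) : ℕ) : ℝ)
      = ∏ x ∈ n.primeFactors, ((n.factorization x + 1 : ℕ) : ℝ) := by push_cast; rfl
    _ ≤ ∏ p ∈ n.primeFactors, (if p < B then K else 1) * ((p : ℝ) ^ (n.factorization p)) ^ ε :=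
        Finset.prod_le_prod (fun _ _ => by positivity) key
    _ = (∏ p ∈ n.primeFactors, (if p < B then K else 1)) * (n : ℝ) ^ ε := by
        rw [Finset.prod_mul_distrib, hfac]
    _ ≤ K ^ B * (n : ℝ) ^ ε := by
        apply mul_le_mul_of_nonneg_right _ (by positivity)
        rw [← Finset.prod_filter, Finset.prod_const]
        apply pow_le_pow_right₀ hK1
        calc _ ≤ (Finset.range B).card := by
              apply Finset.card_le_card
              intro p hp
              simp at hp ⊢
              exact hp.2
          _ = B := by simp

/-- vectors in real 3-space with sup norm -/
abbrev V3 := Fin 3 → ℝ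

def cr (u v : V3) : V3 := ![u 1 * v 2 - u 2 * v 1, u 2 * v 0 - u 0 * v 2, u 0 * v 1 - u 1 * v 0]

def dt (u v w : V3) : ℝ := cr u v 0 * w 0 + cr u v 1 * w 1 + cr u v 2 * w 2

lemma abs_le_nrm (v : V3) (i : Fin 3) : |v i| ≤ ‖v‖ := norm_le_pi_norm v i

lemma nrm_le (v : V3) (r : ℝ) (h0 : |v 0| ≤ r) (h1 : |v 1| ≤ r) (h2 : |v 2| ≤ r) : ‖v‖ ≤ r := by
  rw [pi_norm_le_iff_of_nonneg ((abs_nonneg _).trans h0)]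
  intro i; fin_cases i <;> assumption

lemma exists_coord (v : V3) : ∃ j, |v j| = ‖v‖ := by
  by_contra! h
  have h' : ∀ j, |v j| < ‖v‖ := fun j => lt_of_le_of_ne (abs_le_nrm v j) (h j)
  have hpos : 0 < ‖v‖ := (abs_nonneg _).trans_lt (h' 0)
  have : ‖v‖ < ‖v‖ := (pi_norm_lt_iff hpos).2 h'
  exact lt_irrefl _ this

lemma abs_mul_sub_le {a b c d A B : ℝ} (ha : |a| ≤ A) (hb : |b| ≤ B) (hc : |c| ≤ A) (hd : |d| ≤ B) :
    |a * b - c * d| ≤ 2 * A * B := by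
  have h1 : |a * b| ≤ A * B := by rw [abs_mul]; exact mul_le_mul ha hb (abs_nonneg _) ((abs_nonneg _).trans ha)
  have h2 : |c * d| ≤ A * B := by rw [abs_mul]; exact mul_le_mul hc hd (abs_nonneg _) ((abs_nonneg _).trans hc)
  have := abs_sub (a*b) (c*d)
  linarith

lemma nrm_cr_le (u v : V3) : ‖cr u v‖ ≤ 2 * ‖u‖ * ‖v‖ := by
  apply nrm_le <;> simp only [cr, Matrix.cons_val] <;>
  exact abs_mul_sub_le (abs_le_nrm _ _) (abs_le_nrm _ _) (abs_le_nrm _ _) (abs_le_nrm _ _)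

lemma dt_le (u v w : V3) : |dt u v w| ≤ 3 * ‖cr u v‖ * ‖w‖ := by
  have h : ∀ i, |cr u v i * w i| ≤ ‖cr u v‖ * ‖w‖ := fun i => by
    rw [abs_mul]; exact mul_le_mul (abs_le_nrm _ _) (abs_le_nrm _ _) (abs_nonneg _) (norm_nonneg _)
  unfold dt
  have := abs_add_three (cr u v 0 * w 0) (cr u v 1 * w 1) (cr u v 2 * w 2)
  linarith [h 0, h 1, h 2]

lemma cr_sub (u v w : V3) (i : Fin 3) : cr u (v - w) i = cr u v i - cr u w i := by
  fin_cases i <;> simp [cr] <;> ring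

lemma dt_sub (u v w x : V3) : dt u v (w - x) = dt u v w - dt u v x := by
  simp [dt]; ring

/-- parallel vectors -/
lemma par_of_cr (v q : V3) (h : cr v q = 0) (i j : Fin 3) : q i * v j = q j * v i := by
  have h0 := congrFun h 0
  have h1 := congrFun h 1
  have h2 := congrFun h 2
  simp [cr] at h0 h1 h2
  fin_cases i <;> fin_cases j <;> simp <;> linarith

lemma par_of_dt (v w q : V3) (h : dt v w q = 0) (i j : Fin 3) :
    cr v q i * cr v w j = cr v q j * cr v w i := by
  simp [dt, cr] at h
  fin_cases i <;> fin_cases j <;> simp [cr]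
  · linear_combination -(v 2) * h
  · linear_combination (v 1) * h
  · linear_combination (v 2) * h
  · linear_combination -(v 0) * h
  · linear_combination -(v 1) * h
  · linear_combination (v 0) * h

lemma nrm_of_par (v q : V3) (j : Fin 3) (hj : |v j| = ‖v‖) (hv : v ≠ 0)
    (h : ∀ i, q i * v j = q j * v i) : ‖q‖ = |q j| := by
  have hpos : 0 < ‖v‖ := norm_pos_iff.2 hv
  apply le_antisymm _ (abs_le_nrm _ _)
  rw [pi_norm_le_iff_of_nonneg (abs_nonneg _)]
  intro i
  rw [Real.norm_eq_abs]
  have h1 : |q i| * ‖v‖ = |q j| * |v i| := by rw [← hj, ← abs_mul, h i, abs_mul]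
  have h2 : |q j| * |v i| ≤ |q j| * ‖v‖ := mul_le_mul_of_nonneg_left (abs_le_nrm _ _) (abs_nonneg _)
  exact le_of_mul_le_mul_right (h1.le.trans h2) hpos

lemma sep_card (T : Finset ℝ) (M η : ℝ) (hη : 0 < η) (hM : 0 ≤ M) (hT : ∀ x ∈ T, |x| ≤ M)
    (hs : ∀ x ∈ T, ∀ y ∈ T, x ≠ y → η ≤ |x - y|) : (T.card : ℝ) ≤ 2 * M / η + 1 := by
  have hinj : Set.InjOn (fun x : ℝ => ⌊(x + M) / η⌋₊) T := by
    intro x hx y hy hxy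
    by_contra hne
    have h1 := hs x hx y hy hne
    have hx0 : 0 ≤ (x + M) / η := div_nonneg (by linarith [neg_abs_le x, hT x hx]) hη.le
    have hy0 : 0 ≤ (y + M) / η := div_nonneg (by linarith [neg_abs_le y, hT y hy]) hη.le
    simp only at hxy
    have a1 := Nat.floor_le hx0
    have a2 := Nat.lt_floor_add_one ((x + M) / η)
    have a3 := Nat.floor_le hy0
    have a4 := Nat.lt_floor_add_one ((y + M) / η)
    rw [hxy] at a1 a2
    have h3 : |(x + M) / η - (y + M)/η| < 1 := by rw [abs_lt]; constructor <;> linarith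
    have h4 : (x + M) / η - (y + M)/η = (x - y) / η := by ring
    rw [h4, abs_div, abs_of_pos hη, div_lt_one hη] at h3
    linarith
  have hc : T.card ≤ (Finset.range (⌊2 * M / η⌋₊ + 1)).card := by
    apply Finset.card_le_card_of_injOn _ _ hinj
    intro x hx
    simp only [Finset.coe_range, Set.mem_Iio]
    apply Nat.lt_succ_of_le
    apply Nat.floor_le_floor
    gcongr
    linarith [le_abs_self x, hT x hx]
  rw [Finset.card_range] at hc
  have : (T.card : ℝ) ≤ (⌊2 * M / η⌋₊ : ℝ) + 1 := by exact_mod_cast hc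
  have h2 := Nat.floor_le (show 0 ≤ 2 * M / η by positivity)
  linarith

/-- counting through fibres of a separated real functional -/
lemma fiber_card {ι : Type*} [DecidableEq ι] (F : Finset ι) (f : ι → ℝ) (M η K : ℝ) (hη : 0 < η) (hM : 0 ≤ M)
    (hK : 0 ≤ K)
    (hf : ∀ x ∈ F, |f x| ≤ M) (hs : ∀ x ∈ F, ∀ y ∈ F, f x ≠ f y → η ≤ |f x - f y|)
    (hfib : ∀ c, ((F.filter (fun x => f x = c)).card : ℝ) ≤ K) :
    (F.card : ℝ) ≤ K * (2 * M / η + 1) := by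
  classical
  have h1 := Finset.card_eq_sum_card_image f F
  have h2 : (F.card : ℝ) = ∑ b ∈ F.image f, ((F.filter (fun x => f x = b)).card : ℝ) := by
    rw [h1]; push_cast; rfl
  rw [h2]
  calc _ ≤ ∑ b ∈ F.image f, K := Finset.sum_le_sum (fun b _ => hfib b)
    _ = (F.image f).card * K := by simp
    _ ≤ (2 * M / η + 1) * K := by
      apply mul_le_mul_of_nonneg_right _ hK
      apply sep_card _ _ _ hη hM
      · intro x hx
        obtain ⟨y, hy, rfl⟩ := Finset.mem_image.1 hx
        exact hf y hy
      · intro x hx x' hx' hne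
        obtain ⟨y, hy, rfl⟩ := Finset.mem_image.1 hx
        obtain ⟨y', hy', rfl⟩ := Finset.mem_image.1 hx'
        exact hs y hy y' hy' hne
    _ = _ := mul_comm _ _

lemma line_card (G : Finset V3) (v : V3) (hv : v ≠ 0) (hG : ∀ p ∈ G, ‖p‖ ≤ 1)
    (h : ∀ p ∈ G, ∀ q ∈ G, cr v (p - q) = 0)
    (hmin : ∀ p ∈ G, ∀ q ∈ G, p ≠ q → ‖v‖ ≤ ‖p - q‖) : (G.card : ℝ) ≤ 2 / ‖v‖ + 1 := by
  classical
  obtain ⟨j, hj⟩ := exists_coord v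
  have hpos : 0 < ‖v‖ := norm_pos_iff.2 hv
  have hn : ∀ p ∈ G, ∀ q ∈ G, ‖p - q‖ = |p j - q j| := fun p hp q hq => by
    rw [nrm_of_par v (p - q) j hj hv (fun i => par_of_cr v _ (h p hp q hq) i j)]; rfl
  have := fiber_card G (fun p => p j) 1 ‖v‖ 1 hpos zero_le_one zero_le_one
    (fun p hp => (abs_le_nrm _ _).trans (hG p hp))
    (fun p hp q hq hne => by
      have hpq : p ≠ q := fun e => hne (by rw [e])
      rw [← hn p hp q hq]; exact hmin p hp q hq hpq)
    (fun c => by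
      norm_cast
      rw [Finset.card_le_one]
      intro p hp q hq
      simp only [Finset.mem_filter] at hp hq
      have := hn p hp.1 q hq.1
      rw [hp.2, hq.2, sub_self, abs_zero, norm_eq_zero, sub_eq_zero] at this
      exact this)
  simpa using this

lemma plane_card (G : Finset V3) (v w : V3) (hc : cr v w ≠ 0) (hG : ∀ p ∈ G, ‖p‖ ≤ 1)
    (h : ∀ p ∈ G, ∀ q ∈ G, dt v w (p - q) = 0)
    (hmin2 : ∀ p ∈ G, ∀ q ∈ G, cr v (p - q) ≠ 0 → ‖cr v w‖ ≤ ‖cr v (p - q)‖)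
    (hmin : ∀ p ∈ G, ∀ q ∈ G, p ≠ q → ‖v‖ ≤ ‖p - q‖) :
    (G.card : ℝ) ≤ (2 / ‖v‖ + 1) * (4 * ‖v‖ / ‖cr v w‖ + 1) := by
  classical
  have hv : v ≠ 0 := by
    rintro rfl
    apply hc
    ext i; fin_cases i <;> simp [cr]
  obtain ⟨j, hj⟩ := exists_coord (cr v w)
  have hpos : 0 < ‖cr v w‖ := norm_pos_iff.2 hc
  have hn : ∀ p ∈ G, ∀ q ∈ G, ‖cr v (p - q)‖ = |cr v p j - cr v q j| := fun p hp q hq => by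
    rw [nrm_of_par (cr v w) (cr v (p - q)) j hj hc (fun i => par_of_dt v w _ (h p hp q hq) i j), cr_sub]
  have := fiber_card G (fun p => cr v p j) (2 * ‖v‖) ‖cr v w‖ (2 / ‖v‖ + 1) hpos (by positivity) (by positivity)
    (fun p hp => (abs_le_nrm _ _).trans ((nrm_cr_le v p).trans (by
      have := hG p hp
      have := norm_nonneg v
      nlinarith)))
    (fun p hp q hq hne => by
      rw [← hn p hp q hq]
      apply hmin2 p hp q hq
      intro h0
      have := hn p hp q hq
      rw [h0, norm_zero] at this
      exact hne (by simpa [sub_eq_zero] using this.symm))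
    (fun c => by
      apply line_card _ v hv
      · intro p hp; exact hG p (Finset.mem_filter.1 hp).1
      · intro p hp q hq
        simp only [Finset.mem_filter] at hp hq
        have := hn p hp.1 q hq.1
        rw [hp.2, hq.2, sub_self, abs_zero, norm_eq_zero] at this
        exact this
      · intro p hp q hq
        exact hmin p (Finset.mem_filter.1 hp).1 q (Finset.mem_filter.1 hq).1)
  convert this using 3
  ring

/-- Geometry of numbers bound. -/
theorem gn_card (F : Finset V3) (Λ : Set V3) (a b d : ℝ) (ha : 0 < a) (hb : 0 < b) (hd : 0 < d)
    (hF : ∀ p ∈ F, ‖p‖ ≤ 1) (hΛ : ∀ p ∈ F, ∀ q ∈ F, p - q ∈ Λ)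
    (h1 : ∀ v ∈ Λ, v ≠ 0 → a ≤ ‖v‖)
    (h2 : ∀ v ∈ Λ, ∀ w ∈ Λ, cr v w ≠ 0 → b ≤ ‖cr v w‖)
    (h3 : ∀ v ∈ Λ, ∀ w ∈ Λ, ∀ u ∈ Λ, dt v w u ≠ 0 → d ≤ |dt v w u|) :
    (F.card : ℝ) ≤ 384 * (1 + 1 / a + 1 / b + 1 / d) := by
  classical
  have ia : 0 < 1 / a := by positivity
  have ib : 0 < 1 / b := by positivity
  have id' : 0 < 1 / d := by positivity
  set D : Finset V3 := (F ×ˢ F).image (fun p => p.1 - p.2) with hD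
  have memD : ∀ p ∈ F, ∀ q ∈ F, p - q ∈ D := fun p hp q hq =>
    Finset.mem_image.2 ⟨(p, q), Finset.mem_product.2 ⟨hp, hq⟩, rfl⟩
  have DΛ : ∀ v ∈ D, v ∈ Λ := by
    intro v hv
    obtain ⟨p, hp, rfl⟩ := Finset.mem_image.1 hv
    exact hΛ _ (Finset.mem_product.1 hp).1 _ (Finset.mem_product.1 hp).2
  have D2 : ∀ v ∈ D, ‖v‖ ≤ 2 := by
    intro v hv
    obtain ⟨p, hp, rfl⟩ := Finset.mem_image.1 hv
    have := norm_sub_le p.1 p.2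
    linarith [hF _ (Finset.mem_product.1 hp).1, hF _ (Finset.mem_product.1 hp).2]
  rcases (D.filter (fun v => v ≠ 0)).eq_empty_or_nonempty with he | hne
  · have : F.card ≤ 1 := by
      rw [Finset.card_le_one]
      intro p hp q hq
      by_contra hpq
      have : p - q ∈ D.filter (fun v => v ≠ 0) := Finset.mem_filter.2 ⟨memD p hp q hq, sub_ne_zero.2 hpq⟩
      rw [he] at this; simp at this
    have : (F.card : ℝ) ≤ 1 := by exact_mod_cast this
    linarith
  obtain ⟨v1, hv1, hm1⟩ := Finset.exists_min_image _ (fun v => ‖v‖) hne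
  rw [Finset.mem_filter] at hv1
  have hv1a := h1 v1 (DΛ _ hv1.1) hv1.2
  have hv1p : 0 < ‖v1‖ := ha.trans_le hv1a
  have hv12 := D2 v1 hv1.1
  have hmin : ∀ p ∈ F, ∀ q ∈ F, p ≠ q → ‖v1‖ ≤ ‖p - q‖ := fun p hp q hq hpq =>
    hm1 _ (Finset.mem_filter.2 ⟨memD p hp q hq, sub_ne_zero.2 hpq⟩)
  have f1 : 2 / ‖v1‖ + 1 ≤ 4 / ‖v1‖ := by
    rw [div_add_one hv1p.ne']
    gcongr
    linarith
  have f1' : 1 / ‖v1‖ ≤ 1 / a := by gcongr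
  have g1 : 4 / ‖v1‖ = 4 * (1 / ‖v1‖) := by ring
  rcases (D.filter (fun v => cr v1 v ≠ 0)).eq_empty_or_nonempty with he | hne2
  · have := line_card F v1 hv1.2 hF (fun p hp q hq => by
      by_contra h0
      have : p - q ∈ D.filter (fun v => cr v1 v ≠ 0) := Finset.mem_filter.2 ⟨memD p hp q hq, h0⟩
      rw [he] at this; simp at this) hmin
    linarith
  obtain ⟨v2, hv2, hm2⟩ := Finset.exists_min_image _ (fun v => ‖cr v1 v‖) hne2
  rw [Finset.mem_filter] at hv2
  have hcb := h2 v1 (DΛ _ hv1.1) v2 (DΛ _ hv2.1) hv2.2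
  have hcp : 0 < ‖cr v1 v2‖ := hb.trans_le hcb
  have hc2 : ‖cr v1 v2‖ ≤ 4 * ‖v1‖ := by
    have := nrm_cr_le v1 v2
    nlinarith [D2 v2 hv2.1]
  have hmin2 : ∀ p ∈ F, ∀ q ∈ F, cr v1 (p - q) ≠ 0 → ‖cr v1 v2‖ ≤ ‖cr v1 (p - q)‖ := fun p hp q hq hpq =>
    hm2 _ (Finset.mem_filter.2 ⟨memD p hp q hq, hpq⟩)
  have f2 : 4 * ‖v1‖ / ‖cr v1 v2‖ + 1 ≤ 8 * ‖v1‖ / ‖cr v1 v2‖ := by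
    rw [div_add_one hcp.ne']
    gcongr
    linarith
  have f2' : 1 / ‖cr v1 v2‖ ≤ 1 / b := by gcongr
  have f12 : (2 / ‖v1‖ + 1) * (4 * ‖v1‖ / ‖cr v1 v2‖ + 1) ≤ 32 * (1 / ‖cr v1 v2‖) := by
    calc _ ≤ (4 / ‖v1‖) * (8 * ‖v1‖ / ‖cr v1 v2‖) := by gcongr
      _ = _ := by field_simp; norm_num
  rcases (D.filter (fun v => dt v1 v2 v ≠ 0)).eq_empty_or_nonempty with he | hne3
  · have := plane_card F v1 v2 hv2.2 hF (fun p hp q hq => by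
      by_contra h0
      have : p - q ∈ D.filter (fun v => dt v1 v2 v ≠ 0) := Finset.mem_filter.2 ⟨memD p hp q hq, h0⟩
      rw [he] at this; simp at this) hmin2 hmin
    linarith
  obtain ⟨v3, hv3, hm3⟩ := Finset.exists_min_image _ (fun v => |dt v1 v2 v|) hne3
  rw [Finset.mem_filter] at hv3
  have hdd := h3 v1 (DΛ _ hv1.1) v2 (DΛ _ hv2.1) v3 (DΛ _ hv3.1) hv3.2
  have hdp : 0 < |dt v1 v2 v3| := hd.trans_le hdd
  have hd2 : |dt v1 v2 v3| ≤ 6 * ‖cr v1 v2‖ := by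
    have := dt_le v1 v2 v3
    nlinarith [D2 v3 hv3.1]
  have := fiber_card F (fun p => dt v1 v2 p) (3 * ‖cr v1 v2‖) |dt v1 v2 v3| (32 * (1 / ‖cr v1 v2‖))
    hdp (by positivity) (by positivity)
    (fun p hp => (dt_le v1 v2 p).trans (by
      have := hF p hp
      nlinarith))
    (fun p hp q hq hpq => by
      rw [← dt_sub]
      apply hm3
      refine Finset.mem_filter.2 ⟨memD p hp q hq, ?_⟩
      rw [dt_sub, sub_ne_zero]
      exact hpq)
    (fun c => by
      refine le_trans (plane_card _ v1 v2 hv2.2 ?_ ?_ ?_ ?_) f12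
      · intro p hp; exact hF p (Finset.mem_filter.1 hp).1
      · intro p hp q hq
        simp only [Finset.mem_filter] at hp hq
        rw [dt_sub, hp.2, hq.2, sub_self]
      · intro p hp q hq
        exact hmin2 p (Finset.mem_filter.1 hp).1 q (Finset.mem_filter.1 hq).1
      · intro p hp q hq
        exact hmin p (Finset.mem_filter.1 hp).1 q (Finset.mem_filter.1 hq).1)
  have f3 : 2 * (3 * ‖cr v1 v2‖) / |dt v1 v2 v3| + 1 ≤ 12 * ‖cr v1 v2‖ / |dt v1 v2 v3| := by
    rw [div_add_one hdp.ne']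
    gcongr
    linarith
  have f3' : 1 / |dt v1 v2 v3| ≤ 1 / d := by gcongr
  have f123 : (32 * (1 / ‖cr v1 v2‖)) * (2 * (3 * ‖cr v1 v2‖) / |dt v1 v2 v3| + 1) ≤ 384 * (1 / |dt v1 v2 v3|) := by
    calc _ ≤ (32 * (1 / ‖cr v1 v2‖)) * (12 * ‖cr v1 v2‖ / |dt v1 v2 v3|) := by gcongr
      _ = _ := by field_simp; norm_num
  linarith

/-- traceless matrix with given coordinates -/
def mtV (v : V3) : M2 := !![v 0, v 1 + v 2; v 1 - v 2, - v 0]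

/-- the lattice of coordinates of traceless elements of R(ℓ;g) -/
def Lam (N ℓ : ℕ) (g : M2) : Set V3 := {v | mtV v ∈ Rconj N ℓ g}

def sF (g : M2) (v : V3) : ℝ :=
  v 0 * (g 0 0 * g 1 1 + g 0 1 * g 1 0) + (v 1 - v 2) * (g 0 1 * g 1 1) - g 0 0 * g 1 0 * (v 1 + v 2)
def bF (g : M2) (v : V3) : ℝ :=
  (g 0 0) ^ 2 * (v 1 + v 2) - (g 0 1) ^ 2 * (v 1 - v 2) - 2 * g 0 0 * g 0 1 * v 0
def cF (g : M2) (v : V3) : ℝ :=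
  2 * g 1 0 * g 1 1 * v 0 + (g 1 1) ^ 2 * (v 1 - v 2) - (g 1 0) ^ 2 * (v 1 + v 2)

lemma det_eq {g : M2} (hg : g.det = 1) : g 0 0 * g 1 1 - g 0 1 * g 1 0 = 1 := by
  rw [← Matrix.det_fin_two]; exact hg

lemma inv_eq {g : M2} (hg : g.det = 1) : g⁻¹ = !![g 1 1, - g 0 1; - g 1 0, g 0 0] := by
  rw [Matrix.inv_def, hg, Matrix.adjugate_fin_two]; simp

lemma mem_Lam {N ℓ : ℕ} {g : M2} (hg : g.det = 1) (v : V3) : v ∈ Lam N ℓ g ↔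
    ∃ s b c : ℤ, sF g v = s ∧ bF g v = b / ℓ ∧ cF g v = c * N / ℓ := by
  have e : g * mtV v * g⁻¹ = !![sF g v, bF g v; cF g v, - sF g v] := by
    rw [inv_eq hg]
    ext i j
    fin_cases i <;> fin_cases j <;>
      simp [Matrix.mul_apply, Fin.sum_univ_two, mtV, sF, bF, cF] <;> ring
  unfold Lam Rconj Rlat
  simp only [Set.mem_setOf_eq, e]
  simp only [Matrix.of_apply, Matrix.cons_val', Matrix.cons_val_zero, Matrix.cons_val_one, Matrix.cons_val_fin_one]
  constructor
  · rintro ⟨⟨s, hs⟩, ⟨b, hb⟩, ⟨c, hc⟩, _⟩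
    exact ⟨s, b, c, hs, hb, hc⟩
  · rintro ⟨s, b, c, hs, hb, hc⟩
    exact ⟨⟨s, hs⟩, ⟨b, hb⟩, ⟨c, hc⟩, ⟨-s, by rw [hs]; push_cast; rfl⟩⟩

lemma quad_eq {g : M2} (hg : g.det = 1) (v : V3) :
    sF g v ^ 2 + bF g v * cF g v = v 0 ^ 2 + v 1 ^ 2 - v 2 ^ 2 := by
  have h := det_eq hg
  have h2 : (g 0 0 * g 1 1 - g 0 1 * g 1 0) ^ 2 = 1 := by rw [h]; norm_num
  calc sF g v ^ 2 + bF g v * cF g v = (g 0 0 * g 1 1 - g 0 1 * g 1 0) ^ 2 * (v 0 ^ 2 + v 1 ^ 2 - v 2 ^ 2) := by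
        unfold sF bF cF; ring
    _ = _ := by rw [h2, one_mul]

lemma X_eq {g : M2} (hg : g.det = 1) (v : V3) :
    v 0 = g 0 0 * (g 1 1 * sF g v - g 0 1 * cF g v) + g 1 0 * (g 1 1 * bF g v + g 0 1 * sF g v) := by
  have h := det_eq hg
  have h2 : (g 0 0 * g 1 1 - g 0 1 * g 1 0) ^ 2 = 1 := by rw [h]; norm_num
  unfold sF bF cF; linear_combination - v 0 * h2

lemma Y_eq {g : M2} (hg : g.det = 1) (v : V3) :
    2 * v 1 = g 0 1 * (g 1 1 * sF g v - g 0 1 * cF g v) + g 1 1 * (g 1 1 * bF g v + g 0 1 * sF g v)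
      + g 0 0 * (g 0 0 * cF g v - g 1 0 * sF g v) - g 1 0 * (g 1 0 * bF g v + g 0 0 * sF g v) := by
  have h := det_eq hg
  have h2 : (g 0 0 * g 1 1 - g 0 1 * g 1 0) ^ 2 = 1 := by rw [h]; norm_num
  unfold sF bF cF; linear_combination - 2 * v 1 * h2

lemma W_eq {g : M2} (hg : g.det = 1) (v : V3) :
    2 * v 2 = bF g v * (g 1 0 ^ 2 + g 1 1 ^ 2) + 2 * sF g v * (g 0 0 * g 1 0 + g 0 1 * g 1 1)
      - cF g v * (g 0 0 ^ 2 + g 0 1 ^ 2) := by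
  have h := det_eq hg
  have h2 : (g 0 0 * g 1 1 - g 0 1 * g 1 0) ^ 2 = 1 := by rw [h]; norm_num
  unfold sF bF cF; linear_combination - 2 * v 2 * h2

lemma F_inj {g : M2} (hg : g.det = 1) (v w : V3) (hs : sF g v = sF g w) (hb : bF g v = bF g w)
    (hc : cF g v = cF g w) : v = w := by
  have x1 := X_eq hg v
  have x2 := X_eq hg w
  have y1 := Y_eq hg v
  have y2 := Y_eq hg w
  have w1 := W_eq hg v
  have w2 := W_eq hg w
  rw [hs, hb, hc] at x1 y1 w1
  ext i; fin_cases i <;> simp <;> linarith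

lemma F_zero (g : M2) : sF g 0 = 0 ∧ bF g 0 = 0 ∧ cF g 0 = 0 := by
  simp [sF, bF, cF]

/-- commutator coordinates -/
def cm (u v : V3) : V3 := ![-2 * cr u v 0, -2 * cr u v 1, 2 * cr u v 2]

lemma sF_cm {g : M2} (hg : g.det = 1) (u v : V3) :
    sF g (cm u v) = bF g u * cF g v - bF g v * cF g u := by
  have h := det_eq hg
  have : bF g u * cF g v - bF g v * cF g u = (g 0 0 * g 1 1 - g 0 1 * g 1 0) * sF g (cm u v) := by
    simp [sF, bF, cF, cm, cr]; ring
  rw [this, h, one_mul]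

lemma bF_cm {g : M2} (hg : g.det = 1) (u v : V3) :
    bF g (cm u v) = 2 * (sF g u * bF g v - sF g v * bF g u) := by
  have h := det_eq hg
  have : 2 * (sF g u * bF g v - sF g v * bF g u) = (g 0 0 * g 1 1 - g 0 1 * g 1 0) * bF g (cm u v) := by
    simp [sF, bF, cF, cm, cr]; ring
  rw [this, h, one_mul]

lemma cF_cm {g : M2} (hg : g.det = 1) (u v : V3) :
    cF g (cm u v) = 2 * (cF g u * sF g v - cF g v * sF g u) := by
  have h := det_eq hg
  have : 2 * (cF g u * sF g v - cF g v * sF g u) = (g 0 0 * g 1 1 - g 0 1 * g 1 0) * cF g (cm u v) := by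
    simp [sF, bF, cF, cm, cr]; ring
  rw [this, h, one_mul]

lemma dt_F {g : M2} (hg : g.det = 1) (u v w : V3) :
    dt u v w = -(1/2) * ((bF g u * cF g v - bF g v * cF g u) * sF g w
      + (sF g u * bF g v - sF g v * bF g u) * cF g w + (cF g u * sF g v - cF g v * sF g u) * bF g w) := by
  have h := det_eq hg
  have h2 : (g 0 0 * g 1 1 - g 0 1 * g 1 0) ^ 3 = 1 := by rw [h]; norm_num
  have : -(1/2) * ((bF g u * cF g v - bF g v * cF g u) * sF g w
      + (sF g u * bF g v - sF g v * bF g u) * cF g w + (cF g u * sF g v - cF g v * sF g u) * bF g w)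
      = (g 0 0 * g 1 1 - g 0 1 * g 1 0) ^ 3 * dt u v w := by
    simp [sF, bF, cF, cr, dt]; ring
  rw [this, h2, one_mul]

lemma F_smul (g : M2) (k : ℝ) (v : V3) : sF g (k • v) = k * sF g v ∧ bF g (k • v) = k * bF g v ∧ cF g (k • v) = k * cF g v := by
  simp only [sF, bF, cF, Pi.smul_apply, smul_eq_mul]
  refine ⟨by ring, by ring, by ring⟩

lemma F_sub (g : M2) (v w : V3) : sF g (v - w) = sF g v - sF g w ∧ bF g (v - w) = bF g v - bF g w
    ∧ cF g (v - w) = cF g v - cF g w := by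
  simp only [sF, bF, cF, Pi.sub_apply]
  refine ⟨by ring, by ring, by ring⟩

lemma Lam_sub {N ℓ : ℕ} {g : M2} (hg : g.det = 1) {u v : V3} (hu : u ∈ Lam N ℓ g) (hv : v ∈ Lam N ℓ g) :
    u - v ∈ Lam N ℓ g := by
  rw [mem_Lam hg] at *
  obtain ⟨s, b, c, hs, hb, hc⟩ := hu
  obtain ⟨s', b', c', hs', hb', hc'⟩ := hv
  obtain ⟨e1, e2, e3⟩ := F_sub g u v
  refine ⟨s - s', b - b', c - c', ?_, ?_, ?_⟩
  · rw [e1, hs, hs']; push_cast; ring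
  · rw [e2, hb, hb']; push_cast; ring
  · rw [e3, hc, hc']; push_cast; ring

lemma cm_mem {ℓ M : ℕ} {g : M2} (hg : g.det = 1) (hℓ : 0 < ℓ) (hM : 0 < M) {u v : V3}
    (hu : u ∈ Lam (ℓ * M) ℓ g) (hv : v ∈ Lam (ℓ * M) ℓ g) :
    ((ℓ : ℝ) / M) • cm u v ∈ Lam (ℓ * M) M g := by
  have hℓ' : (ℓ : ℝ) ≠ 0 := by positivity
  have hM' : (M : ℝ) ≠ 0 := by positivity
  rw [mem_Lam hg] at *
  obtain ⟨s, b, c, hs, hb, hc⟩ := hu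
  obtain ⟨s', b', c', hs', hb', hc'⟩ := hv
  obtain ⟨e1, e2, e3⟩ := F_smul g ((ℓ : ℝ) / M) (cm u v)
  refine ⟨b * c' - b' * c, 2 * (s * b' - s' * b), 2 * (c * s' - c' * s), ?_, ?_, ?_⟩
  · rw [e1, sF_cm hg, hb, hc, hb', hc']; push_cast; field_simp
  · rw [e2, bF_cm hg, hs, hb, hs', hb']; push_cast; field_simp
  · rw [e3, cF_cm hg, hs, hc, hs', hc']; push_cast; field_simp

lemma one_le_abs_int {n : ℤ} (h : n ≠ 0) : (1:ℝ) ≤ |(n:ℝ)| := by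
  rw [← Int.cast_abs]; exact_mod_cast Int.one_le_abs h

lemma dt_min {ℓ M : ℕ} {g : M2} (hg : g.det = 1) (hℓ : 0 < ℓ) (hM : 0 < M) {u v w : V3}
    (hu : u ∈ Lam (ℓ * M) ℓ g) (hv : v ∈ Lam (ℓ * M) ℓ g) (hw : w ∈ Lam (ℓ * M) ℓ g) (h : dt u v w ≠ 0) :
    (M : ℝ) / (2 * ℓ) ≤ |dt u v w| := by
  have hℓ' : (ℓ : ℝ) ≠ 0 := by positivity
  have hM' : (M : ℝ) ≠ 0 := by positivity
  rw [mem_Lam hg] at *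
  obtain ⟨s, b, c, hs, hb, hc⟩ := hu
  obtain ⟨s', b', c', hs', hb', hc'⟩ := hv
  obtain ⟨s2, b2, c2, hs2, hb2, hc2⟩ := hw
  have e : dt u v w = ((M : ℝ) / (2 * ℓ)) *
      ((-((b * c' - b' * c) * s2 + (s * b' - s' * b) * c2 + (c * s' - c' * s) * b2) : ℤ) : ℝ) := by
    rw [dt_F hg, hs, hb, hc, hs', hb', hc', hs2, hb2, hc2]
    push_cast
    field_simp
  rw [e, abs_mul, abs_of_nonneg (by positivity : (0:ℝ) ≤ (M : ℝ) / (2 * ℓ))]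
  apply le_mul_of_one_le_right (by positivity)
  apply one_le_abs_int
  intro h0
  rw [h0] at e
  apply h; rw [e]; simp

/-- the positive quadratic form attached to g -/
def EqF (g : M2) (α β : ℝ) : ℝ := (α * g 0 0 + β * g 1 0) ^ 2 + (α * g 0 1 + β * g 1 1) ^ 2

def Dg (g : M2) : ℝ := g 1 0 ^ 2 + g 1 1 ^ 2

lemma Dg_pos {g : M2} (hg : g.det = 1) : 0 < Dg g := by
  have h := det_eq hg
  unfold Dg
  by_contra hn
  have h1 : g 1 0 = 0 := by nlinarith [sq_nonneg (g 1 0), sq_nonneg (g 1 1)]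
  have h2 : g 1 1 = 0 := by nlinarith [sq_nonneg (g 1 0), sq_nonneg (g 1 1)]
  rw [h1, h2] at h; norm_num at h

lemma Eq_Dg {g : M2} (hg : g.det = 1) (α β : ℝ) :
    EqF g α β * Dg g = (α * (g 0 0 * g 1 0 + g 0 1 * g 1 1) + β * Dg g) ^ 2 + α ^ 2 := by
  have h := det_eq hg
  unfold EqF Dg
  linear_combination α ^ 2 * (g 0 0 * g 1 1 - g 0 1 * g 1 0 + 1) * h

lemma moebius_I_im (h : M2) : (moebius h Complex.I).im = h.det / (h 1 0 ^ 2 + h 1 1 ^ 2) := by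
  unfold moebius
  rw [Complex.div_im, Matrix.det_fin_two]
  simp [Complex.normSq_apply]
  rw [← sub_div]
  congr 1 <;> ring

lemma moebius_comp (m g : M2) (hg : g.det = 1) :
    moebius m (moebius g Complex.I) = moebius (m * g) Complex.I := by
  have hD := Dg_pos hg
  have hw : ((g 1 0 : ℂ) * Complex.I + (g 1 1 : ℂ)) ≠ 0 := by
    intro h0
    have h1 := congrArg Complex.re h0
    have h2 := congrArg Complex.im h0
    simp at h1 h2
    unfold Dg at hD
    rw [h1, h2] at hD; norm_num at hD
  unfold moebius
  rw [← mul_div_mul_right _ _ hw]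
  congr 1
  · rw [add_mul, mul_assoc, div_mul_cancel₀ _ hw]
    simp [Matrix.mul_apply, Fin.sum_univ_two]; ring
  · rw [add_mul, mul_assoc, div_mul_cancel₀ _ hw]
    simp [Matrix.mul_apply, Fin.sum_univ_two]; ring

lemma im_formula (m g : M2) (hm : m.det = 1) (hg : g.det = 1) :
    (moebius m (moebius g Complex.I)).im = 1 / EqF g (m 1 0) (m 1 1) := by
  rw [moebius_comp m g hg, moebius_I_im, Matrix.det_mul, hm, hg]
  simp [Matrix.mul_apply, Fin.sum_univ_two, EqF]

lemma Eq_smul (g : M2) (k α β : ℝ) : EqF g (k * α) (k * β) = k ^ 2 * EqF g α β := by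
  unfold EqF; ring

lemma AL_det {N Q : ℕ} (hQ : 0 < Q) (hQN : Q ∣ N) (a b c d : ℤ) :
    ((Real.sqrt Q)⁻¹ • !![(Q : ℝ) * a, (b : ℝ); (N : ℝ) * c, (Q : ℝ) * d] : M2).det =
      ((Q * a * d - (N / Q : ℕ) * b * c : ℤ) : ℝ) := by
  obtain ⟨M, rfl⟩ := hQN
  have hQ' : (Q : ℝ) ≠ 0 := by positivity
  have hs : (Real.sqrt Q)⁻¹ ^ 2 = (Q : ℝ)⁻¹ := by rw [inv_pow, Real.sq_sqrt (by positivity)]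
  rw [Matrix.det_smul, Matrix.det_fin_two]
  simp [Nat.mul_div_cancel_left _ hQ, hs]
  field_simp

lemma bdd {N : ℕ} (hN : 0 < N) {g : M2} (hg : g.det = 1) :
    BddAbove ((fun σ => (moebius σ (moebius g Complex.I)).im) '' AtkinLehner N) := by
  have hD := Dg_pos hg
  refine ⟨Dg g + 1 / Dg g, ?_⟩
  rintro _ ⟨σ, ⟨hσ, Q, a, b, c, d, hQ, hQN, rfl⟩, rfl⟩
  simp only
  rw [im_formula _ g hσ hg]
  rw [AL_det hQ hQN] at hσ
  have hQN' : (Q : ℝ) ≤ N := by exact_mod_cast Nat.le_of_dvd hN hQN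
  have hQp : (0:ℝ) < Q := by positivity
  have hNp : (1:ℝ) ≤ N := by exact_mod_cast hN
  have hs : (Real.sqrt Q)⁻¹ ^ 2 = (Q : ℝ)⁻¹ := by rw [inv_pow, Real.sq_sqrt (by positivity)]
  simp only [Matrix.smul_apply, Matrix.of_apply, Matrix.cons_val', Matrix.cons_val_zero, Matrix.cons_val_one, Matrix.cons_val_fin_one, smul_eq_mul]
  rw [Eq_smul, hs]
  by_cases hc : c = 0
  · subst hc
    have h1 : (Q * a * d : ℤ) = 1 := by
      have : (((Q * a * d - (N / Q : ℕ) * b * 0 : ℤ)) : ℝ) = ((1 : ℤ) : ℝ) := by rw [hσ]; simp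
      have := Int.cast_injective this
      simpa using this
    have hQd : (Q : ℤ) * d ∣ 1 := ⟨a, by rw [← h1]; ring⟩
    have hQ1 : (Q : ℤ) ∣ 1 := (dvd_mul_right _ _).trans hQd
    have hQ1' : Q = 1 := by
      have : Q ∣ 1 := by exact_mod_cast hQ1
      exact Nat.dvd_one.1 this
    subst hQ1'
    have hd : (d:ℝ)^2 = 1 := by
      have : d ∣ 1 := by simpa using hQd
      have : IsUnit d := isUnit_of_dvd_one this
      have := Int.isUnit_iff.1 this
      rcases this with h | h <;> rw [h] <;> norm_num
    have e : EqF g ((N:ℝ) * ((0:ℤ):ℝ)) (((1:ℕ):ℝ) * d) = Dg g := by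
      unfold EqF Dg; push_cast
      linear_combination (g 1 0 ^ 2 + g 1 1 ^ 2) * hd
    rw [e]
    simp
    exact hD.le
  · have h1 : 1 ≤ (c:ℝ)^2 := by
      have := one_le_abs_int hc
      rw [← sq_abs]; nlinarith
    have hE : (N:ℝ)^2 ≤ EqF g ((N:ℝ) * c) (Q * d) * Dg g := by
      rw [Eq_Dg hg]
      have := sq_nonneg (N * c * (g 0 0 * g 1 0 + g 0 1 * g 1 1) + Q * d * Dg g)
      have : (N:ℝ)^2 ≤ ((N:ℝ) * c)^2 := by rw [mul_pow]; nlinarith [sq_nonneg (N:ℝ)]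
      linarith
    have hEp : 0 < EqF g ((N:ℝ) * c) (Q * d) := by
      by_contra hn
      have : EqF g ((N:ℝ) * c) (Q * d) * Dg g ≤ 0 := mul_nonpos_of_nonpos_of_nonneg (not_lt.1 hn) hD.le
      nlinarith
    have : 1 / ((Q:ℝ)⁻¹ * EqF g ((N:ℝ) * c) (Q * d)) ≤ Dg g := by
      rw [div_le_iff₀ (by positivity)]
      have : (Q:ℝ) ≤ EqF g ((N:ℝ) * c) (Q * d) * Dg g := by nlinarith
      have h3 : Dg g * ((Q:ℝ)⁻¹ * EqF g ((N:ℝ) * c) (Q * d)) = (EqF g ((N:ℝ) * c) (Q * d) * Dg g) / Q := by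
        field_simp
      rw [h3, le_div_iff₀ hQp]; linarith
    have : 0 < 1 / Dg g := by positivity
    linarith

lemma one_mem_AL (N : ℕ) : (1 : M2) ∈ AtkinLehner N := by
  refine ⟨by simp, 1, 1, 0, 0, 1, one_pos, one_dvd _, ?_⟩
  ext i j; fin_cases i <;> fin_cases j <;> simp

lemma Hgt_ge {N : ℕ} (hN : 0 < N) {g : M2} (hg : g.det = 1) {σ : M2} (hσ : σ ∈ AtkinLehner N) :
    1 / EqF g (σ 1 0) (σ 1 1) ≤ Hgt N g := by
  rw [← im_formula σ g hσ.1 hg]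
  exact le_csSup (bdd hN hg) ⟨σ, hσ, rfl⟩

lemma inv_Dg_le {N : ℕ} (hN : 0 < N) {g : M2} (hg : g.det = 1) : 1 / Dg g ≤ Hgt N g := by
  have := Hgt_ge hN hg (one_mem_AL N)
  convert this using 2
  simp [EqF, Dg]

lemma Hgt_pos {N : ℕ} (hN : 0 < N) {g : M2} (hg : g.det = 1) : 0 < Hgt N g :=
  lt_of_lt_of_le (by have := Dg_pos hg; positivity) (inv_Dg_le hN hg)

lemma Eq_pos {g : M2} (hg : g.det = 1) {α β : ℝ} (h : α ≠ 0 ∨ β ≠ 0) : 0 < EqF g α β := by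
  have hD := Dg_pos hg
  have h1 := Eq_Dg hg α β
  have : 0 < EqF g α β * Dg g := by
    rw [h1]
    by_cases ha : α = 0
    · have hb : β ≠ 0 := by tauto
      rw [ha]; simp; positivity
    · positivity
  exact (mul_pos_iff_of_pos_right hD).1 this

/-- Atkin-Lehner completion of a coprime bottom row -/
lemma AL_le {N : ℕ} (hN : 0 < N) (hsq : Squarefree N) {g : M2} (hg : g.det = 1) (c e : ℤ)
    (hce : IsCoprime c e) : ∃ (Q K : ℕ) (d : ℤ), 0 < Q ∧ N = Q * K ∧ e = Q * d ∧
      IsCoprime ((Q:ℤ) * d) ((K:ℤ) * c) ∧ (Q : ℝ) ≤ Hgt N g * EqF g (N * c) e := by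
  set Q : ℕ := Int.gcd e N with hQ
  have hQ0 : 0 < Q := Int.gcd_pos_of_ne_zero_right _ (by exact_mod_cast hN.ne')
  have hQN : Q ∣ N := by
    have := Int.gcd_dvd_right e (N:ℤ)
    exact_mod_cast this
  obtain ⟨d, hd⟩ : (Q:ℤ) ∣ e := Int.gcd_dvd_left _ _
  obtain ⟨K, hK⟩ := hQN
  have hQK : IsCoprime (Q:ℤ) (K:ℤ) := by
    rw [Nat.isCoprime_iff_coprime]
    rw [hK] at hsq
    exact Nat.coprime_of_squarefree_mul hsq
  have hdK : IsCoprime d (K:ℤ) := by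
    have h1 : Int.gcd ((Q:ℤ) * d) ((Q:ℤ) * K) = Q := by
      have : ((Q:ℤ) * K) = (N:ℤ) := by rw [hK]; push_cast; rfl
      rw [this, ← hd]
    rw [Int.gcd_mul_left] at h1
    rw [Int.isCoprime_iff_gcd_eq_one]
    rw [Int.natAbs_natCast] at h1
    exact Nat.eq_of_mul_eq_mul_left hQ0 (h1.trans (mul_one _).symm)
  have hcop : IsCoprime ((Q:ℤ) * d) ((K:ℤ) * c) := by
    rw [hd] at hce
    have h2 := hce.symm
    exact IsCoprime.mul_right (IsCoprime.mul_left hQK hdK) h2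
  refine ⟨Q, K, d, hQ0, hK, hd, hcop, ?_⟩
  obtain ⟨x, y, hxy⟩ := hcop
  have hKN : N / Q = K := by rw [hK]; exact Nat.mul_div_cancel_left _ hQ0
  have hmem : ((Real.sqrt Q)⁻¹ • !![(Q : ℝ) * x, ((-y : ℤ) : ℝ); (N : ℝ) * c, (Q : ℝ) * d] : M2) ∈ AtkinLehner N := by
    refine ⟨?_, Q, x, -y, c, d, hQ0, ⟨K, hK⟩, rfl⟩
    rw [AL_det hQ0 ⟨K, hK⟩, hKN]
    have : (Q * x * d - K * (-y) * c : ℤ) = 1 := by rw [← hxy]; ring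
    rw [this]; simp
  have := Hgt_ge hN hg hmem
  have hs : (Real.sqrt Q)⁻¹ ^ 2 = (Q : ℝ)⁻¹ := by rw [inv_pow, Real.sq_sqrt (by positivity)]
  simp only [Matrix.smul_apply, Matrix.of_apply, Matrix.cons_val', Matrix.cons_val_zero, Matrix.cons_val_one, Matrix.cons_val_fin_one, smul_eq_mul] at this
  rw [Eq_smul, hs] at this
  have he : (e:ℝ) = Q * d := by rw [hd]; push_cast; rfl
  rw [he]
  have hE : 0 < EqF g ((N:ℝ) * c) (Q * d) := by
    apply Eq_pos hg
    by_contra hn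
    push Not at hn
    have hNr : (N:ℝ) ≠ 0 := by positivity
    have hQr : (Q:ℝ) ≠ 0 := by positivity
    have hc0 : c = 0 := by
      have := hn.1; simp [hNr] at this; exact this
    have hd0 : d = 0 := by
      have := hn.2; simp [hQr] at this; exact this
    rw [hc0, hd0] at hxy; simp at hxy
  rw [div_le_iff₀ (by positivity)] at this
  have hQp : (0:ℝ) < Q := by positivity
  have h3 : Hgt N g * ((Q:ℝ)⁻¹ * EqF g ((N:ℝ) * c) (Q * d)) = (Hgt N g * EqF g ((N:ℝ) * c) (Q * d)) / Q := by
    field_simp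
  rw [h3, le_div_iff₀ hQp] at this
  linarith

lemma AL_le' {N : ℕ} (hN : 0 < N) (hsq : Squarefree N) {g : M2} (hg : g.det = 1) (c e : ℤ)
    (hce : c ≠ 0 ∨ e ≠ 0) : 1 ≤ Hgt N g * EqF g (N * c) e := by
  have hgp : 0 < Int.gcd c e := by
    rcases hce with h | h
    · exact Int.gcd_pos_of_ne_zero_left _ h
    · exact Int.gcd_pos_of_ne_zero_right _ h
  obtain ⟨c', e', hcop, hc, he⟩ := Int.exists_gcd_one hgp
  have := AL_le hN hsq hg c' e' (Int.isCoprime_iff_gcd_eq_one.2 hcop)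
  obtain ⟨Q, K, d, hQ, -, -, -, hle⟩ := this
  have hQ1 : (1:ℝ) ≤ Q := by exact_mod_cast hQ
  have hk : (1:ℝ) ≤ (Int.gcd c e : ℝ) := by exact_mod_cast hgp
  have e1 : EqF g (N * c) e = (Int.gcd c e : ℝ) ^ 2 * EqF g (N * c') e' := by
    rw [← Eq_smul]
    congr 1
    · conv_lhs => rw [hc]
      push_cast; ring
    · conv_lhs => rw [he]
      push_cast; ring
  rw [e1]
  nlinarith

lemma Hgt_lower {N : ℕ} (hN : 0 < N) (hsq : Squarefree N) {g : M2} (hg : g.det = 1) :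
    1 ≤ 2 * N * Hgt N g := by
  have hD := Dg_pos hg
  have hH := Hgt_pos hN hg
  have hNp : (0:ℝ) < N := by positivity
  by_cases hDN : Dg g ≤ N
  · have := inv_Dg_le hN hg
    rw [div_le_iff₀ hD] at this
    nlinarith
  · push Not at hDN
    set n : ℕ := ⌊Real.sqrt (Dg g / N)⌋₊ with hn
    have hq1 : 1 ≤ Dg g / N := by rw [one_le_div hNp]; exact hDN.le
    have hn1 : 0 < n := Nat.floor_pos.2 (Real.one_le_sqrt.2 hq1)
    have hnle : (n:ℝ) ^ 2 ≤ Dg g / N := by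
      have := Nat.floor_le (Real.sqrt_nonneg (Dg g / N))
      calc (n:ℝ)^2 ≤ (Real.sqrt (Dg g / N))^2 := by gcongr
        _ = _ := Real.sq_sqrt (by positivity)
    have hngt : Dg g / N ≤ ((n:ℝ) + 1) ^ 2 := by
      have := (Nat.lt_floor_add_one (Real.sqrt (Dg g / N))).le
      calc _ = (Real.sqrt (Dg g / N))^2 := (Real.sq_sqrt (by positivity)).symm
        _ ≤ _ := by gcongr
    set x : ℝ := (g 0 0 * g 1 0 + g 0 1 * g 1 1) / Dg g with hx
    obtain ⟨j, k, hk0, hkn, hjk⟩ := Real.exists_int_int_abs_mul_sub_le (N * x) hn1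
    have h1 := AL_le' hN hsq hg k (-j) (Or.inl hk0.ne')
    have h2 := Eq_Dg hg (N * k) ((-j : ℤ) : ℝ)
    have h3 : (N * k * (g 0 0 * g 1 0 + g 0 1 * g 1 1) + ((-j : ℤ) : ℝ) * Dg g) = (k * (N * x) - j) * Dg g := by
      rw [hx]; push_cast; field_simp; ring
    rw [h3] at h2
    have hE : EqF g (N * k) ((-j : ℤ) : ℝ) ≤ 2 * N := by
      have e1 : ((k:ℝ) * (N * x) - j)^2 ≤ 1 / ((n:ℝ)+1)^2 := by
        rw [← sq_abs, ← _root_.one_div_pow]; gcongr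
      have e2 : ((k:ℝ) * (N * x) - j)^2 * Dg g ≤ N := by
        have : ((k:ℝ) * (N * x) - j)^2 * ((n:ℝ)+1)^2 ≤ 1 := by
          rwa [le_div_iff₀ (by positivity)] at e1
        rw [div_le_iff₀ hNp] at hngt
        calc ((k:ℝ) * (N * x) - j)^2 * Dg g ≤ ((k:ℝ) * (N * x) - j)^2 * (((n:ℝ)+1)^2 * N) := by gcongr
          _ = (((k:ℝ) * (N * x) - j)^2 * ((n:ℝ)+1)^2) * N := by ring
          _ ≤ 1 * N := by gcongr
          _ = N := one_mul _
      have e3 : ((N:ℝ) * k)^2 ≤ N * Dg g := by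
        have hkn' : (k:ℝ) ≤ n := by exact_mod_cast hkn
        have hk0' : (0:ℝ) < k := by exact_mod_cast hk0
        have : (k:ℝ)^2 ≤ Dg g / N := le_trans (by gcongr) hnle
        rw [le_div_iff₀ hNp] at this
        nlinarith
      have : EqF g (N * k) ((-j : ℤ) : ℝ) * Dg g ≤ (2 * N) * Dg g := by
        rw [h2]; nlinarith
      exact le_of_mul_le_mul_right this hD
    nlinarith

lemma EqF_W {g : M2} (hg : g.det = 1) (v : V3) (h0 : v 0 ^ 2 + v 1 ^ 2 - v 2 ^ 2 = 0) :
    EqF g (cF g v) (-sF g v) = - cF g v * (2 * v 2) := by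
  have hq := quad_eq hg v
  rw [h0] at hq
  rw [W_eq hg v]
  unfold EqF
  linear_combination (g 1 0 ^ 2 + g 1 1 ^ 2) * hq

/-- minimum lemma -/
lemma min_lem {N ℓ : ℕ} (hN : 0 < N) (hsq : Squarefree N) (hℓ : 0 < ℓ) (hd : ℓ ∣ N) {g : M2} (hg : g.det = 1)
    {v : V3} (hv : v ∈ Lam N ℓ g) (hv0 : v ≠ 0) :
    1 / (ℓ:ℝ) ≤ |v 0 ^ 2 + v 1 ^ 2 - v 2 ^ 2| ∨
      (v 0 ^ 2 + v 1 ^ 2 - v 2 ^ 2 = 0 ∧ 1 ≤ 2 * ℓ * Hgt N g * |v 2|) := by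
  obtain ⟨M, hM⟩ := hd
  have hH := Hgt_pos hN hg
  have hℓr : (0:ℝ) < ℓ := by positivity
  have hNr : (0:ℝ) < N := by positivity
  have hNM : (N:ℝ) = ℓ * M := by rw [hM]; push_cast; rfl
  obtain ⟨s, b, c, hs, hb, hc⟩ := (mem_Lam hg v).1 hv
  have hq := quad_eq hg v
  have hqint : ((ℓ * s ^ 2 + b * c * M : ℤ) : ℝ) = ℓ * (v 0 ^ 2 + v 1 ^ 2 - v 2 ^ 2) := by
    rw [← hq, hs, hb, hc, hNM]; push_cast; field_simp
  by_cases hz : (ℓ * s ^ 2 + b * c * M : ℤ) = 0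
  · right
    have h0 : v 0 ^ 2 + v 1 ^ 2 - v 2 ^ 2 = 0 := by
      rw [hz] at hqint
      have : (ℓ:ℝ) * (v 0 ^ 2 + v 1 ^ 2 - v 2 ^ 2) = 0 := by rw [← hqint]; simp
      exact (mul_eq_zero.1 this).resolve_left hℓr.ne'
    refine ⟨h0, ?_⟩
    by_cases hc0 : c = 0
    · subst hc0
      have hs0 : s = 0 := by
        have : (ℓ : ℤ) * s ^ 2 = 0 := by simpa using hz
        rcases mul_eq_zero.1 this with h | h
        · exact absurd (by exact_mod_cast h) hℓ.ne'
        · exact pow_eq_zero_iff (two_ne_zero) |>.1 h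
      subst hs0
      have hb0 : b ≠ 0 := by
        rintro rfl
        apply hv0
        obtain ⟨z1, z2, z3⟩ := F_zero g
        apply F_inj hg
        · rw [hs, z1]; simp
        · rw [hb, z2]; simp
        · rw [hc, z3]; simp
      have hW := W_eq hg v
      rw [hs, hb, hc] at hW
      have hW' : 2 * v 2 = b / ℓ * Dg g := by rw [hW]; unfold Dg; push_cast; ring
      have hD := Dg_pos hg
      have h1 := inv_Dg_le hN hg
      rw [div_le_iff₀ hD] at h1
      have : 2 * |v 2| = |(b:ℝ)| / ℓ * Dg g := by
        have := congrArg abs hW'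
        rw [abs_mul, abs_mul, abs_div, abs_of_pos hD, abs_of_pos hℓr] at this
        simpa using this
      calc (1:ℝ) ≤ |(b:ℝ)| * (Hgt N g * Dg g) := by nlinarith [one_le_abs_int hb0]
        _ = ℓ * Hgt N g * (|(b:ℝ)| / ℓ * Dg g) := by field_simp
        _ = _ := by rw [← this]; ring
    · obtain ⟨c0, e, hcop, hcg, heg⟩ := Int.exists_gcd_one (Int.gcd_pos_of_ne_zero_left (-(ℓ:ℤ) * s) hc0)
      have hgp : 0 < Int.gcd c (-(ℓ:ℤ) * s) := Int.gcd_pos_of_ne_zero_left _ hc0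
      obtain ⟨g0, hg0⟩ : ∃ g0 : ℕ, g0 = Int.gcd c (-(ℓ:ℤ) * s) := ⟨_, rfl⟩
      rw [← hg0] at hcg heg hgp
      obtain ⟨Q, K, d, hQ, hNQ, hed, hco, hle⟩ := AL_le hN hsq hg c0 e (Int.isCoprime_iff_gcd_eq_one.2 hcop)
      have hc00 : c0 ≠ 0 := by rintro rfl; apply hc0; rw [hcg]; simp
      have hNZ : (N:ℤ) = ℓ * M := by rw [hM]; push_cast; rfl
      have hNZ' : (N:ℤ) = Q * K := by rw [hNQ]; push_cast; rfl
      have key : (g0:ℤ) * (Q * d * d) = -b * (K * c0) := by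
        have e1 : (-(ℓ:ℤ) * s)^2 = - b * c * N := by rw [hNZ]; linear_combination (ℓ:ℤ) * hz
        rw [heg, hed, hNZ'] at e1
        rw [hcg] at e1
        have : ((g0:ℤ) * Q) * ((g0:ℤ) * (Q * d * d)) = ((g0:ℤ) * Q) * (-b * (K * c0)) := by
          linear_combination e1
        have hne : ((g0:ℤ) * Q) ≠ 0 := by positivity
        exact mul_left_cancel₀ hne this
      have hdiv : (K:ℤ) * c0 ∣ g0 := by
        have hco2 : IsCoprime ((K:ℤ) * c0) (Q * d * d) :=
          (IsCoprime.mul_left hco (hco.of_mul_left_right)).symm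
        exact hco2.dvd_of_dvd_mul_right ⟨-b, by rw [key]; ring⟩
      have hKle : (K:ℝ) * |(c0:ℝ)| ≤ g0 := by
        have := Int.le_of_dvd (by positivity) ((abs_dvd _ _).2 hdiv)
        have h2 : ((|(K:ℤ) * c0| : ℤ) : ℝ) ≤ ((g0:ℤ):ℝ) := by exact_mod_cast this
        rw [Int.cast_abs] at h2
        push_cast at h2
        rwa [abs_mul, Nat.abs_cast] at h2
      have hE := EqF_W hg v h0
      have a1 : cF g v = (g0 / ℓ : ℝ) * (N * c0) := by
        rw [hc, hcg]; push_cast; ring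
      have a2 : - sF g v = (g0 / ℓ : ℝ) * e := by
        rw [hs]
        have : ((-(ℓ:ℤ) * s : ℤ) : ℝ) = ((e * g0 : ℤ) : ℝ) := by exact_mod_cast heg
        push_cast at this
        field_simp
        linarith
      rw [a2] at hE
      rw [a1, Eq_smul] at hE
      have hgr : (0:ℝ) < g0 := by positivity
      have hE2 : (g0:ℝ) * EqF g (N * c0) e = ℓ * N * |(c0:ℝ)| * (2 * |v 2|) := by
        have e3 : (g0:ℝ) * EqF g (N * c0) e = - (ℓ * N * c0 * (2 * v 2)) := by
          have : (g0 / ℓ : ℝ) * ((g0:ℝ) * EqF g (N * c0) e) = (g0 / ℓ : ℝ) * (- (ℓ * N * c0 * (2 * v 2))) := by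
            calc _ = ℓ * ((g0 / ℓ : ℝ) ^ 2 * EqF g (N * c0) e) := by field_simp
              _ = _ := by rw [hE]; field_simp
          exact mul_left_cancel₀ (by positivity) this
        have hEn : 0 ≤ EqF g (N * c0) e := by unfold EqF; positivity
        have e4 := congrArg abs e3
        rw [abs_of_nonneg (by positivity), abs_neg, abs_mul, abs_mul, abs_mul, abs_mul, abs_of_pos hℓr, abs_of_pos hNr] at e4
        simpa using e4
      have hcp : 0 < |(c0:ℝ)| := lt_of_lt_of_le one_pos (one_le_abs_int hc00)
      have hNQr : (N:ℝ) = Q * K := by rw [hNQ]; push_cast; rfl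
      have f1 : (N:ℝ) * |(c0:ℝ)| * 1 ≤ (N:ℝ) * |(c0:ℝ)| * (2 * ℓ * Hgt N g * |v 2|) := by
        calc (N:ℝ) * |(c0:ℝ)| * 1 = Q * (K * |(c0:ℝ)|) := by rw [hNQr]; ring
          _ ≤ Q * g0 := by gcongr
          _ ≤ (Hgt N g * EqF g (N * c0) e) * g0 := by gcongr
          _ = Hgt N g * ((g0:ℝ) * EqF g (N * c0) e) := by ring
          _ = _ := by rw [hE2]; ring
      exact le_of_mul_le_mul_left f1 (by positivity)
  · left
    have h1 := one_le_abs_int hz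
    rw [hqint, abs_mul, abs_of_pos hℓr] at h1
    rw [div_le_iff₀ hℓr]; linarith

/-- diagonal scaling -/
def sc (A B : ℝ) (v : V3) : V3 := ![A * v 0, A * v 1, B * v 2]

lemma sc_inv {A B : ℝ} (hA : 0 < A) (hB : 0 < B) (v : V3) : sc A B (sc A⁻¹ B⁻¹ v) = v := by
  ext i; fin_cases i <;> simp [sc] <;> field_simp

lemma sc_sub (A B : ℝ) (v w : V3) : sc A B (v - w) = sc A B v - sc A B w := by
  ext i; fin_cases i <;> simp [sc] <;> ring

lemma dt_sc (A B : ℝ) (u v w : V3) : dt (sc A B u) (sc A B v) (sc A B w) = A ^ 2 * B * dt u v w := by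
  simp [dt, sc, cr]; ring

set_option maxHeartbeats 1600000 in
lemma T_lem {ℓ M : ℕ} (hℓ : 0 < ℓ) (hM : 0 < M) (hsq : Squarefree (ℓ * M)) {g : M2} (hg : g.det = 1)
    (F : Finset V3) (hF : ∀ u ∈ F, ∀ v ∈ F, u - v ∈ Lam (ℓ * M) ℓ g) (A d : ℝ) (hA : 0 < A) (hd : 0 < d)
    (hd1 : d ≤ 1) (hbox : ∀ u ∈ F, |u 0| ≤ A ∧ |u 1| ≤ A ∧ |u 2| ≤ d * A) :
    (F.card : ℝ) ≤ 2400 * (1 + √ℓ * A + ℓ * Hgt (ℓ * M) g * d * A + ℓ / √M * A ^ 2 +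
      ℓ * Hgt (ℓ * M) g * d * A ^ 2 + ℓ / M * d * A ^ 3) := by
  have hN : 0 < ℓ * M := Nat.mul_pos hℓ hM
  have hH := Hgt_pos hN hg
  set H := Hgt (ℓ * M) g with hHdef
  have hℓr : (0:ℝ) < ℓ := by positivity
  have hMr : (0:ℝ) < M := by positivity
  set q := √(ℓ:ℝ) with hq
  set p := √(M:ℝ) with hp
  have hq0 : 0 < q := Real.sqrt_pos.2 hℓr
  have hp0 : 0 < p := Real.sqrt_pos.2 hMr
  have hq2 : q ^ 2 = ℓ := Real.sq_sqrt hℓr.le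
  have hp2 : p ^ 2 = M := Real.sq_sqrt hMr.le
  have hB : 0 < d * A := by positivity
  have hinj : Function.Injective (sc A⁻¹ (d * A)⁻¹) := fun x y h => by
    rw [← sc_inv hA hB x, h, sc_inv hA hB y]
  have hcard : (F.image (sc A⁻¹ (d * A)⁻¹)).card = F.card := Finset.card_image_of_injective _ hinj
  have main := gn_card (F.image (sc A⁻¹ (d * A)⁻¹)) {w | sc A (d * A) w ∈ Lam (ℓ * M) ℓ g}
    (1 / (2 * q * A + 2 * ℓ * H * d * A)) (1 / (3 * (ℓ / p) * A ^ 2 + 6 * ℓ * H * d * A ^ 2))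
    (1 / (2 * (ℓ / M) * d * A ^ 3)) (by positivity) (by positivity) (by positivity) ?_ ?_ ?_ ?_ ?_
  · rw [hcard] at main
    simp only [one_div_one_div] at main
    refine main.trans ?_
    have t1 : 0 < q * A := by positivity
    have t2 : 0 < ℓ * H * d * A := by positivity
    have t3 : 0 < ℓ / p * A ^ 2 := by positivity
    have t4 : 0 < ℓ * H * d * A ^ 2 := by positivity
    have t5 : 0 < ℓ / M * d * A ^ 3 := by positivity
    nlinarith
  · intro w hw
    obtain ⟨u, hu, rfl⟩ := Finset.mem_image.1 hw
    obtain ⟨b0, b1, b2⟩ := hbox u hu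
    apply nrm_le <;> simp only [sc, Matrix.cons_val] <;> rw [abs_mul, abs_inv, abs_of_pos (by assumption)]
    · rw [inv_mul_le_iff₀ hA]; linarith
    · rw [inv_mul_le_iff₀ hA]; linarith
    · rw [inv_mul_le_iff₀ hB]; linarith
  · intro w hw w' hw'
    obtain ⟨u, hu, rfl⟩ := Finset.mem_image.1 hw
    obtain ⟨u', hu', rfl⟩ := Finset.mem_image.1 hw'
    show sc A (d * A) _ ∈ Lam (ℓ * M) ℓ g
    rw [sc_sub, sc_inv hA hB, sc_inv hA hB]
    exact hF u hu u' hu'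
  · intro w hw hw0
    have hne : sc A (d * A) w ≠ 0 := by
      intro h0
      apply hw0
      have e0 := congrFun h0 0
      have e1 := congrFun h0 1
      have e2 := congrFun h0 2
      simp [sc, hA.ne', hd.ne'] at e0 e1 e2
      ext i; fin_cases i <;> simp [*]
    have hwn : 0 < ‖w‖ := norm_pos_iff.2 hw0
    rw [div_le_iff₀ (by positivity)]
    have n0 := abs_le_nrm w 0
    have n1 := abs_le_nrm w 1
    have n2 := abs_le_nrm w 2
    have tt2 : 0 < ‖w‖ * (2 * ℓ * H * d * A) := by positivity
    have tt1 : 0 < ‖w‖ * (2 * q * A) := by positivity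
    rcases min_lem hN hsq hℓ (dvd_mul_right _ _) hg hw hne with h | ⟨-, h⟩
    · simp only [sc, Matrix.cons_val] at h
      have s0 : (w 0) ^ 2 ≤ ‖w‖ ^ 2 := by rw [← sq_abs]; gcongr
      have s1 : (w 1) ^ 2 ≤ ‖w‖ ^ 2 := by rw [← sq_abs]; gcongr
      have s2 : (w 2) ^ 2 ≤ ‖w‖ ^ 2 := by rw [← sq_abs]; gcongr
      have hd2 : d ^ 2 ≤ 1 := by nlinarith
      have k0 : (A * w 0) ^ 2 ≤ A ^ 2 * ‖w‖ ^ 2 := by rw [mul_pow]; gcongr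
      have k1 : (A * w 1) ^ 2 ≤ A ^ 2 * ‖w‖ ^ 2 := by rw [mul_pow]; gcongr
      have k2 : (d * A * w 2) ^ 2 ≤ A ^ 2 * ‖w‖ ^ 2 := by
        calc (d * A * w 2) ^ 2 = d ^ 2 * (A ^ 2 * (w 2) ^ 2) := by ring
          _ ≤ 1 * (A ^ 2 * ‖w‖ ^ 2) := by gcongr
          _ = _ := one_mul _
      have h' : 1 / (ℓ:ℝ) ≤ 2 * (A ^ 2 * ‖w‖ ^ 2) := by
        refine h.trans (abs_le.2 ⟨?_, ?_⟩)
        · nlinarith [sq_nonneg (A * w 0), sq_nonneg (A * w 1)]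
        · nlinarith [sq_nonneg (d * A * w 2)]
      rw [div_le_iff₀ hℓr, ← hq2] at h'
      have : 1 ≤ ‖w‖ * (2 * q * A) := by
        by_contra hc
        push Not at hc
        nlinarith
      linarith
    · simp only [sc, Matrix.cons_val] at h
      rw [abs_mul, abs_of_pos hB] at h
      have : 2 * ℓ * H * (d * A * |w 2|) ≤ 2 * ℓ * H * (d * A * ‖w‖) := by gcongr
      linarith
  · intro v hv w hw hcr
    set c := ‖cr v w‖ with hc
    have hcp : 0 < c := norm_pos_iff.2 hcr
    set v' := sc A (d * A) v with hv'
    set w' := sc A (d * A) w with hw'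
    have hmem := cm_mem hg hℓ hM (u := v') (v := w') hv hw
    set k : ℝ := (ℓ:ℝ) / M with hk
    have hkp : 0 < k := by positivity
    have m0 : (k • cm v' w') 0 = - (2 * k * (d * A ^ 2)) * cr v w 0 := by
      simp [cm, cr, hv', hw', sc]; ring
    have m1 : (k • cm v' w') 1 = - (2 * k * (d * A ^ 2)) * cr v w 1 := by
      simp [cm, cr, hv', hw', sc]; ring
    have m2 : (k • cm v' w') 2 = (2 * k * A ^ 2) * cr v w 2 := by
      simp [cm, cr, hv', hw', sc]; ring
    have hne : k • cm v' w' ≠ 0 := by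
      intro h0
      apply hcr
      rw [h0] at m0 m1 m2
      simp at m0 m1 m2
      have hMne : M ≠ 0 := hM.ne'
      have hℓne : ℓ ≠ 0 := hℓ.ne'
      have e0 : cr v w 0 = 0 := by
        rcases m0 with h | h
        · exfalso; rcases h with h | h
          · exact hkp.ne' h
          · rcases h with h | h <;> linarith
        · exact h
      have e1 : cr v w 1 = 0 := by
        rcases m1 with h | h
        · exfalso; rcases h with h | h
          · exact hkp.ne' h
          · rcases h with h | h <;> linarith
        · exact h
      have e2 : cr v w 2 = 0 := by
        rcases m2 with h | h
        · exfalso; rcases h with h | h <;> linarith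
        · exact h
      ext i; fin_cases i <;> simp [e0, e1, e2]
    have n0 : |cr v w 0| ≤ c := abs_le_nrm _ 0
    have n1 : |cr v w 1| ≤ c := abs_le_nrm _ 1
    have n2 : |cr v w 2| ≤ c := abs_le_nrm _ 2
    have s0 : (cr v w 0) ^ 2 ≤ c ^ 2 := by rw [← sq_abs]; gcongr
    have s1 : (cr v w 1) ^ 2 ≤ c ^ 2 := by rw [← sq_abs]; gcongr
    have s2 : (cr v w 2) ^ 2 ≤ c ^ 2 := by rw [← sq_abs]; gcongr
    have hd2 : d ^ 2 ≤ 1 := by nlinarith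
    have k0 : ((k • cm v' w') 0) ^ 2 ≤ (2 * k * A ^ 2) ^ 2 * (d ^ 2 * c ^ 2) := by
      rw [m0]
      calc _ = (2 * k * A ^ 2) ^ 2 * (d ^ 2 * (cr v w 0) ^ 2) := by ring
        _ ≤ _ := by gcongr
    have k1 : ((k • cm v' w') 1) ^ 2 ≤ (2 * k * A ^ 2) ^ 2 * (d ^ 2 * c ^ 2) := by
      rw [m1]
      calc _ = (2 * k * A ^ 2) ^ 2 * (d ^ 2 * (cr v w 1) ^ 2) := by ring
        _ ≤ _ := by gcongr
    have k2 : ((k • cm v' w') 2) ^ 2 ≤ (2 * k * A ^ 2) ^ 2 * c ^ 2 := by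
      rw [m2, mul_pow]; gcongr
    rw [div_le_iff₀ (by positivity)]
    have tt1 : 0 < c * (3 * (ℓ / p) * A ^ 2) := by positivity
    have tt2 : 0 < c * (6 * ℓ * H * d * A ^ 2) := by positivity
    have hkd : (2 * k * A ^ 2) ^ 2 * (d ^ 2 * c ^ 2) ≤ (2 * k * A ^ 2) ^ 2 * c ^ 2 := by
      have : d ^ 2 * c ^ 2 ≤ c ^ 2 := by nlinarith [sq_nonneg c]
      gcongr
    rcases min_lem hN hsq hM (dvd_mul_left _ _) hg hmem hne with h | ⟨h00, h⟩
    · have h' : 1 / (M:ℝ) ≤ 2 * ((2 * k * A ^ 2) ^ 2 * c ^ 2) := by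
        refine h.trans (abs_le.2 ⟨?_, ?_⟩)
        · nlinarith [sq_nonneg ((k • cm v' w') 0), sq_nonneg ((k • cm v' w') 1)]
        · nlinarith [sq_nonneg ((k • cm v' w') 2)]
      have hkp' : k * p = ℓ / p := by rw [hk, ← hp2]; field_simp
      rw [div_le_iff₀ hMr, ← hp2] at h'
      have h3 : 1 ≤ 8 * ((ℓ / p) * A ^ 2 * c) ^ 2 := by
        rw [← hkp']; nlinarith
      have h4 : 0 < (ℓ / p) * A ^ 2 * c := by positivity
      have : 1 ≤ 3 * ((ℓ / p) * A ^ 2 * c) := by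
        by_contra hcc
        push Not at hcc
        nlinarith
      linarith
    · have hsq' : ((k • cm v' w') 2) ^ 2 ≤ (3 * k * A ^ 2 * d * c) ^ 2 := by nlinarith [sq_nonneg (k * A ^ 2 * d * c)]
      have hab : |(k • cm v' w') 2| ≤ 3 * k * A ^ 2 * d * c := abs_le_of_sq_le_sq hsq' (by positivity)
      have : 2 * M * H * |(k • cm v' w') 2| ≤ 2 * M * H * (3 * k * A ^ 2 * d * c) := by gcongr
      have e : 2 * M * H * (3 * k * A ^ 2 * d * c) = c * (6 * ℓ * H * d * A ^ 2) := by
        rw [hk]; field_simp; ring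
      rw [← hHdef] at h
      linarith
  · intro v hv w hw u hu h
    have hB2 : 0 < A ^ 2 * (d * A) := by positivity
    have h1 := dt_min hg hℓ hM hv hw hu (by rw [dt_sc]; exact mul_ne_zero hB2.ne' h)
    rw [dt_sc, abs_mul, abs_of_pos hB2] at h1
    rw [div_le_iff₀ (by positivity)]
    rw [div_le_iff₀ (by positivity)] at h1
    rw [show |dt v w u| * (2 * (↑ℓ / ↑M) * d * A ^ 3) = (A ^ 2 * (d * A) * |dt v w u| * (2 * ↑ℓ)) / M by field_simp, le_div_iff₀ hMr]
    linarith

lemma fiber_real {α β : Type*} [DecidableEq β] (F : Finset α) (f : α → β) (T : Finset β) (K : ℝ)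
    (hf : ∀ a ∈ F, f a ∈ T) (hK : ∀ b ∈ T, ((F.filter (fun a => f a = b)).card : ℝ) ≤ K) :
    (F.card : ℝ) ≤ T.card * K := by
  rw [Finset.card_eq_sum_card_fiberwise (f := f) (t := T) (fun a ha => hf a ha)]
  push_cast
  calc _ ≤ ∑ b ∈ T, K := Finset.sum_le_sum hK
    _ = _ := by simp

/-- residues: key arithmetic step -/
lemma class_arith {M : ℕ} (hM : 0 < M) (hsq : Squarefree M) {s s' s1 : ℤ}
    (h : (M:ℤ) ∣ s ^ 2 - s1 ^ 2) (h' : (M:ℤ) ∣ s' ^ 2 - s1 ^ 2)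
    (he : Int.gcd (M:ℤ) (s - s1) = Int.gcd (M:ℤ) (s' - s1)) : (M:ℤ) ∣ s - s' := by
  have step : ∀ t : ℤ, (M:ℤ) ∣ t ^ 2 - s1 ^ 2 → ∀ e f : ℕ, Int.gcd (M:ℤ) (t - s1) = e → M = e * f →
      (f:ℤ) ∣ t + s1 := by
    intro t ht e f hge hef
    have hcop : IsCoprime (f:ℤ) (t - s1) := by
      rw [Int.isCoprime_iff_gcd_eq_one]
      have hco : Nat.Coprime e f := by rw [hef] at hsq; exact Nat.coprime_of_squarefree_mul hsq
      have h1 : Int.gcd (f:ℤ) (t - s1) ∣ f := by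
        have := Int.gcd_dvd_left (f:ℤ) (t - s1); exact_mod_cast this
      have h2 : Int.gcd (f:ℤ) (t - s1) ∣ e := by
        rw [← hge]
        apply Int.dvd_gcd
        · rw [hef]; push_cast; exact (Int.gcd_dvd_left _ _).mul_left _
        · exact Int.gcd_dvd_right _ _
      exact Nat.eq_one_of_dvd_coprimes hco h2 h1
    have hfd : (f:ℤ) ∣ (t - s1) * (t + s1) := by
      have : (f:ℤ) ∣ M := by rw [hef]; push_cast; exact dvd_mul_left _ _
      have h3 := this.trans ht
      rwa [show t ^ 2 - s1 ^ 2 = (t - s1) * (t + s1) by ring] at h3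
    exact hcop.dvd_of_dvd_mul_left hfd
  obtain ⟨f, hf⟩ : Int.gcd (M:ℤ) (s - s1) ∣ M := by
    have := Int.gcd_dvd_left (M:ℤ) (s - s1); exact_mod_cast this
  have a1 := step s h _ f rfl hf
  have a2 := step s' h' _ f he.symm hf
  have b1 : ((Int.gcd (M:ℤ) (s - s1) : ℕ) : ℤ) ∣ s - s1 := Int.gcd_dvd_right _ _
  have b2 : ((Int.gcd (M:ℤ) (s - s1) : ℕ) : ℤ) ∣ s' - s1 := by rw [he]; exact Int.gcd_dvd_right _ _
  have c1 : ((Int.gcd (M:ℤ) (s - s1) : ℕ) : ℤ) ∣ s - s' := by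
    have := dvd_sub b1 b2; simpa using this
  have c2 : (f:ℤ) ∣ s - s' := by
    have := dvd_sub a1 a2; simpa using this
  have hco : IsCoprime ((Int.gcd (M:ℤ) (s - s1) : ℕ) : ℤ) (f:ℤ) := by
    rw [Nat.isCoprime_iff_coprime]
    apply Nat.coprime_of_squarefree_mul
    rw [← hf]; exact hsq
  have := hco.mul_dvd c1 c2
  rw [show (M:ℤ) = ((Int.gcd (M:ℤ) (s - s1) : ℕ) : ℤ) * (f:ℤ) by exact_mod_cast hf]
  exact this

/-- decomposition in residue classes -/
lemma class_card {ℓ M : ℕ} (hℓ : 0 < ℓ) (hM : 0 < M) (hsq : Squarefree (ℓ * M)) {g : M2} (hg : g.det = 1)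
    (F : Finset V3) (hF : ∀ u ∈ F, u ∈ Lam (ℓ * M) ℓ g) (m : ℝ)
    (hm : ∀ u ∈ F, u 0 ^ 2 + u 1 ^ 2 - u 2 ^ 2 = m) (K : ℝ) (hK0 : 0 ≤ K)
    (hK : ∀ G ⊆ F, (∀ u ∈ G, ∀ v ∈ G, ∃ k : ℤ, sF g u - sF g v = M * k) → (G.card : ℝ) ≤ K) :
    (F.card : ℝ) ≤ (Nat.divisors M).card * K := by
  classical
  have hℓr : (ℓ:ℝ) ≠ 0 := by positivity
  have hMr : (M:ℝ) ≠ 0 := by positivity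
  rcases F.eq_empty_or_nonempty with rfl | ⟨u1, hu1⟩
  · simp; positivity
  have hsF : ∀ u ∈ F, sF g u = ((round (sF g u) : ℤ) : ℝ) := by
    intro u hu
    obtain ⟨s, b, c, hs, -, -⟩ := (mem_Lam hg u).1 (hF u hu)
    rw [hs, round_intCast]
  have hdv : ∀ u ∈ F, (M:ℤ) ∣ (round (sF g u)) ^ 2 - (round (sF g u1)) ^ 2 := by
    intro u hu
    obtain ⟨s, b, c, hs, hb, hc⟩ := (mem_Lam hg u).1 (hF u hu)
    obtain ⟨s1, b1, c1, hs1, hb1, hc1⟩ := (mem_Lam hg u1).1 (hF u1 hu1)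
    rw [hs, hs1, round_intCast, round_intCast]
    have q1 := quad_eq hg u
    have q2 := quad_eq hg u1
    rw [hm u hu, hs, hb, hc] at q1
    rw [hm u1 hu1, hs1, hb1, hc1] at q2
    have e : (ℓ:ℤ) * (s ^ 2 - s1 ^ 2) = M * (b1 * c1 - b * c) := by
      have : (((ℓ:ℤ) * (s ^ 2 - s1 ^ 2) : ℤ) : ℝ) = ((M * (b1 * c1 - b * c) : ℤ) : ℝ) := by
        push_cast at *
        field_simp at q1 q2
        linear_combination q1 - q2
      exact_mod_cast this
    have hco : IsCoprime (M:ℤ) (ℓ:ℤ) := by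
      rw [Nat.isCoprime_iff_coprime]
      exact (Nat.coprime_of_squarefree_mul hsq).symm
    exact hco.dvd_of_dvd_mul_left ⟨_, e⟩
  have hsqM : Squarefree M := hsq.of_mul_right
  apply fiber_real F (fun u => Int.gcd (M:ℤ) (round (sF g u) - round (sF g u1))) (Nat.divisors M) K
  · intro u hu
    rw [Nat.mem_divisors]
    refine ⟨?_, hM.ne'⟩
    have := Int.gcd_dvd_left (M:ℤ) (round (sF g u) - round (sF g u1)); exact_mod_cast this
  · intro e he
    apply hK _ (Finset.filter_subset _ _)
    intro u hu v hv
    rw [Finset.mem_filter] at hu hv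
    obtain ⟨k, hk⟩ := class_arith hM hsqM (hdv u hu.1) (hdv v hv.1) (hu.2.trans hv.2.symm)
    refine ⟨k, ?_⟩
    rw [hsF u hu.1, hsF v hv.1]
    exact_mod_cast hk

/-- class count through the dual lattice -/
lemma r_class {ℓ M : ℕ} (hℓ : 0 < ℓ) (hM : 0 < M) (hsq : Squarefree (ℓ * M)) {g : M2} (hg : g.det = 1)
    (G : Finset V3) (hG : ∀ u ∈ G, u ∈ Lam (ℓ * M) ℓ g)
    (hs : ∀ u ∈ G, ∀ v ∈ G, ∃ k : ℤ, sF g u - sF g v = M * k)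
    (A d : ℝ) (hA : 0 < A) (hd : 0 < d)
    (hd1 : d ≤ 1) (hbox : ∀ u ∈ G, |u 0| ≤ A ∧ |u 1| ≤ A ∧ |u 2| ≤ d * A) :
    (G.card : ℝ) ≤ 2400 * (1 + √(ℓ * M : ℝ) * (A / M) + ℓ * Hgt (ℓ * M) g * d * A + ℓ * M * (A / M) ^ 2 +
      ℓ * M * Hgt (ℓ * M) g * d * (A / M) ^ 2 + ℓ * M * d * (A / M) ^ 3) := by
  classical
  have hℓr : (0:ℝ) < ℓ := by positivity
  have hMr : (0:ℝ) < M := by positivity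
  have hinj : Function.Injective (fun v : V3 => ((M:ℝ)⁻¹) • v) := smul_right_injective _ (by positivity)
  have hcard := Finset.card_image_of_injective G hinj
  have hsq' : Squarefree ((ℓ * M) * 1) := by rwa [mul_one]
  have := T_lem (ℓ := ℓ * M) (M := 1) (Nat.mul_pos hℓ hM) one_pos hsq' hg
    (G.image (fun v : V3 => ((M:ℝ)⁻¹) • v)) ?_ (A / M) d (by positivity) hd hd1 ?_
  · rw [hcard, mul_one] at this
    push_cast at this
    rw [Real.sqrt_one, div_one] at this
    have e : (ℓ:ℝ) * M * Hgt (ℓ * M) g * d * (A / M) = ℓ * Hgt (ℓ * M) g * d * A := by field_simp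
    rw [e] at this
    exact this
  · intro x hx y hy
    obtain ⟨u, hu, rfl⟩ := Finset.mem_image.1 hx
    obtain ⟨v, hv, rfl⟩ := Finset.mem_image.1 hy
    rw [← smul_sub, mem_Lam hg]
    obtain ⟨s, b, c, -, hb, hc⟩ := (mem_Lam hg _).1 (Lam_sub hg (hG u hu) (hG v hv))
    obtain ⟨k, hk⟩ := hs u hu v hv
    obtain ⟨e1, e2, e3⟩ := F_smul g ((M:ℝ)⁻¹) (u - v)
    refine ⟨k, b, c, ?_, ?_, ?_⟩
    · rw [e1, (F_sub g u v).1, hk]; field_simp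
    · rw [e2, hb]; push_cast; field_simp
    · rw [e3, hc]; push_cast; field_simp
  · intro x hx
    obtain ⟨u, hu, rfl⟩ := Finset.mem_image.1 hx
    obtain ⟨b0, b1, b2⟩ := hbox u hu
    simp only [Pi.smul_apply, smul_eq_mul, abs_mul, abs_inv, Nat.abs_cast]
    refine ⟨?_, ?_, ?_⟩
    · rw [inv_mul_le_iff₀ hMr, mul_div_cancel₀ _ hMr.ne']; exact b0
    · rw [inv_mul_le_iff₀ hMr, mul_div_cancel₀ _ hMr.ne']; exact b1
    · rw [inv_mul_le_iff₀ hMr, show (M:ℝ) * (d * (A / M)) = d * A by field_simp]; exact b2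

lemma F_mul (σ g : M2) (v : V3) :
    sF (σ * g) v = sF g v * (σ 0 0 * σ 1 1 + σ 0 1 * σ 1 0) + cF g v * (σ 0 1 * σ 1 1) - bF g v * (σ 0 0 * σ 1 0) ∧
    bF (σ * g) v = (σ 0 0) ^ 2 * bF g v - (σ 0 1) ^ 2 * cF g v - 2 * σ 0 0 * σ 0 1 * sF g v ∧
    cF (σ * g) v = 2 * σ 1 0 * σ 1 1 * sF g v + (σ 1 1) ^ 2 * cF g v - (σ 1 0) ^ 2 * bF g v := by
  simp only [sF, bF, cF, Matrix.mul_apply, Fin.sum_univ_two]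
  refine ⟨by ring, by ring, by ring⟩

lemma Lam_AL {ℓ M : ℕ} (hℓ : 0 < ℓ) (hM : 0 < M) {g : M2} (hg : g.det = 1) {σ : M2}
    (hσ : σ ∈ AtkinLehner (ℓ * M)) {v : V3} (hv : v ∈ Lam (ℓ * M) ℓ g) : v ∈ Lam (ℓ * M) ℓ (σ * g) := by
  have hdet : (σ * g).det = 1 := by rw [Matrix.det_mul, hσ.1, hg, one_mul]
  obtain ⟨hσ1, Q, a, b, c, d, hQ, ⟨K, hK⟩, rfl⟩ := hσ
  have hℓr : (ℓ:ℝ) ≠ 0 := by positivity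
  have hMr : (M:ℝ) ≠ 0 := by positivity
  have hQr : (Q:ℝ) ≠ 0 := by positivity
  have hKr : (ℓ:ℝ) * M = Q * K := by exact_mod_cast hK
  have hs2 : (√(Q:ℝ))⁻¹ * (√(Q:ℝ))⁻¹ = (Q:ℝ)⁻¹ := by
    rw [← mul_inv, Real.mul_self_sqrt (by positivity)]
  rw [mem_Lam hdet]
  obtain ⟨s, β, γ, hs, hb, hc⟩ := (mem_Lam hg v).1 hv
  obtain ⟨e1, e2, e3⟩ := F_mul ((Real.sqrt Q)⁻¹ • !![(Q : ℝ) * a, (b : ℝ); ((ℓ * M : ℕ) : ℝ) * c, (Q : ℝ) * d]) g v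
  simp only [Matrix.smul_apply, Matrix.of_apply, Matrix.cons_val', Matrix.cons_val_zero, Matrix.cons_val_one, Matrix.cons_val_fin_one, smul_eq_mul] at e1 e2 e3
  rw [hs, hb, hc] at e1 e2 e3
  have hcast : ((ℓ * M : ℕ) : ℝ) = ℓ * M := by push_cast; rfl
  refine ⟨(Q * a * d + K * b * c) * s + M * b * d * γ - M * a * c * β,
    Q * a ^ 2 * β - b ^ 2 * K * γ - 2 * a * b * ℓ * s,
    2 * ℓ * c * d * s + Q * d ^ 2 * γ - K * c ^ 2 * β, ?_, ?_, ?_⟩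
  · rw [e1, hcast]
    have : ∀ S : ℝ, S * S = (Q:ℝ)⁻¹ →
      s * (S * (Q * a) * (S * (Q * d)) + S * b * (S * (ℓ * M * c))) + γ * (ℓ * M) / ℓ * (S * b * (S * (Q * d)))
        - β / ℓ * (S * (Q * a) * (S * (ℓ * M * c))) =
      (S * S) * (s * ((Q * a) * (Q * d) + b * (ℓ * M * c)) + γ * (ℓ * M) / ℓ * (b * (Q * d))
        - β / ℓ * ((Q * a) * (ℓ * M * c))) := by intros; ring
    rw [this _ hs2, hs2]
    push_cast
    field_simp
    linear_combination (b * s * c : ℝ) * hKr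
  · rw [e2, hcast]
    have : ∀ S : ℝ, S * S = (Q:ℝ)⁻¹ →
      (S * (Q * a)) ^ 2 * (β / ℓ) - (S * b) ^ 2 * (γ * (ℓ * M) / ℓ) - 2 * (S * (Q * a)) * (S * b) * s =
      (S * S) * ((Q * a) ^ 2 * (β / ℓ) - b ^ 2 * (γ * (ℓ * M) / ℓ) - 2 * (Q * a) * b * s) := by intros; ring
    rw [this _ hs2, hs2]
    push_cast
    field_simp
    linear_combination (- b ^ 2 * γ : ℝ) * hKr
  · rw [e3, hcast]
    have : ∀ S : ℝ, S * S = (Q:ℝ)⁻¹ →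
      2 * (S * (ℓ * M * c)) * (S * (Q * d)) * s + (S * (Q * d)) ^ 2 * (γ * (ℓ * M) / ℓ) - (S * (ℓ * M * c)) ^ 2 * (β / ℓ)
       = (S * S) * (2 * (ℓ * M * c) * (Q * d) * s + (Q * d) ^ 2 * (γ * (ℓ * M) / ℓ) - (ℓ * M * c) ^ 2 * (β / ℓ)) := by intros; ring
    rw [this _ hs2, hs2]
    push_cast
    field_simp
    linear_combination (- c ^ 2 * β : ℝ) * hKr

lemma Dg_mul (σ g : M2) : Dg (σ * g) = EqF g (σ 1 0) (σ 1 1) := by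
  simp [Dg, EqF, Matrix.mul_apply, Fin.sum_univ_two]

lemma exists_good {ℓ M : ℕ} (hℓ : 0 < ℓ) (hM : 0 < M) {g : M2} (hg : g.det = 1) :
    ∃ h : M2, h.det = 1 ∧ (∀ v ∈ Lam (ℓ * M) ℓ g, v ∈ Lam (ℓ * M) ℓ h) ∧
      Hgt (ℓ * M) g * Dg h < 2 ∧ 1 ≤ Hgt (ℓ * M) g * Dg h ∧ |h 0 0 * h 1 0 + h 0 1 * h 1 1| ≤ Dg h := by
  have hN : 0 < ℓ * M := Nat.mul_pos hℓ hM
  have hH := Hgt_pos hN hg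
  have hne : ((fun σ => (moebius σ (moebius g Complex.I)).im) '' AtkinLehner (ℓ * M)).Nonempty :=
    ⟨_, 1, one_mem_AL _, rfl⟩
  obtain ⟨_, ⟨σ, hσ, rfl⟩, hlt⟩ := exists_lt_of_lt_csSup hne (show Hgt (ℓ * M) g / 2 < Hgt (ℓ * M) g by linarith)
  simp only at hlt
  rw [im_formula σ g hσ.1 hg, ← Dg_mul] at hlt
  have hge := Hgt_ge hN hg hσ
  rw [← Dg_mul] at hge
  have hd1 : (σ * g).det = 1 := by rw [Matrix.det_mul, hσ.1, hg, one_mul]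
  have hD := Dg_pos hd1
  rw [lt_div_iff₀ hD] at hlt
  rw [div_le_iff₀ hD] at hge
  set h1 := σ * g with hh1
  set x := (h1 0 0 * h1 1 0 + h1 0 1 * h1 1 1) / Dg h1 with hx
  have hn : (!![1, ((-⌊x⌋ : ℤ) : ℝ); 0, 1] : M2) ∈ AtkinLehner (ℓ * M) := by
    refine ⟨by simp [Matrix.det_fin_two], 1, 1, -⌊x⌋, 0, 1, one_pos, one_dvd _, ?_⟩
    ext i j; fin_cases i <;> fin_cases j <;> simp
  have hDn : Dg (!![1, ((-⌊x⌋ : ℤ) : ℝ); 0, 1] * h1) = Dg h1 := by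
    simp [Dg, Matrix.mul_apply, Fin.sum_univ_two]
  refine ⟨!![1, ((-⌊x⌋ : ℤ) : ℝ); 0, 1] * h1, ?_, ?_, ?_, ?_, ?_⟩
  · rw [Matrix.det_mul, hn.1, hd1, one_mul]
  · intro v hv
    exact Lam_AL hℓ hM hd1 hn (Lam_AL hℓ hM hg hσ hv)
  · rw [hDn]; linarith
  · rw [hDn]; linarith
  · rw [hDn]
    have e : (!![1, ((-⌊x⌋ : ℤ) : ℝ); 0, 1] * h1 : M2) 0 0 * (!![1, ((-⌊x⌋ : ℤ) : ℝ); 0, 1] * h1 : M2) 1 0 +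
      (!![1, ((-⌊x⌋ : ℤ) : ℝ); 0, 1] * h1 : M2) 0 1 * (!![1, ((-⌊x⌋ : ℤ) : ℝ); 0, 1] * h1 : M2) 1 1 = (x - ⌊x⌋) * Dg h1 := by
      have : x * Dg h1 = (h1 0 0 * h1 1 0 + h1 0 1 * h1 1 1) := by rw [hx]; field_simp
      rw [sub_mul, this]
      simp [Dg, Matrix.mul_apply, Fin.sum_univ_two]; ring
    rw [e, abs_mul, abs_of_pos hD]
    have : |x - ⌊x⌋| ≤ 1 := by
      rw [abs_of_nonneg (by linarith [Int.floor_le x])]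
      linarith [Int.lt_floor_add_one x]
    nlinarith

lemma c_bound (h : M2) (v : V3) : |cF h v| ≤ Dg h * (|v 0| + |v 1| + |v 2|) := by
  have e : cF h v = 2 * h 1 0 * h 1 1 * v 0 + ((h 1 1) ^ 2 - (h 1 0) ^ 2) * v 1 + (- Dg h) * v 2 := by
    unfold cF Dg; ring
  have a1 : |2 * h 1 0 * h 1 1| ≤ Dg h := by
    unfold Dg; rw [abs_le]; constructor <;> nlinarith [sq_nonneg (h 1 0 + h 1 1), sq_nonneg (h 1 0 - h 1 1)]
  have a2 : |(h 1 1) ^ 2 - (h 1 0) ^ 2| ≤ Dg h := by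
    unfold Dg; rw [abs_le]; constructor <;> nlinarith [sq_nonneg (h 1 0), sq_nonneg (h 1 1)]
  have a3 : |-Dg h| ≤ Dg h := by
    rw [abs_neg, abs_of_nonneg]; unfold Dg; positivity
  rw [e]
  calc _ ≤ |2 * h 1 0 * h 1 1 * v 0| + |((h 1 1) ^ 2 - (h 1 0) ^ 2) * v 1| + |(- Dg h) * v 2| := abs_add_three _ _ _
    _ ≤ Dg h * |v 0| + Dg h * |v 1| + Dg h * |v 2| := by
      rw [abs_mul _ (v 0), abs_mul _ (v 1), abs_mul _ (v 2)]; gcongr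
    _ = _ := by ring

lemma s_bound {h : M2} (hh : h.det = 1) (v : V3) (hx : |h 0 0 * h 1 0 + h 0 1 * h 1 1| ≤ Dg h) :
    |sF h v| ≤ |v 0| + |v 1| + Dg h * (|v 0| + |v 1| + |v 2|) := by
  have hD := Dg_pos hh
  have hdet := det_eq hh
  have e : Dg h * sF h v = cF h v * (h 0 0 * h 1 0 + h 0 1 * h 1 1)
      + (((h 1 1) ^ 2 - (h 1 0) ^ 2) * v 0 + (- 2 * h 1 0 * h 1 1) * v 1) := by
    unfold Dg sF cF
    linear_combination (((h 1 1) ^ 2 - (h 1 0) ^ 2) * v 0 + (- 2 * h 1 0 * h 1 1) * v 1) * hdet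
  have a1 : |-2 * h 1 0 * h 1 1| ≤ Dg h := by
    unfold Dg; rw [abs_le]; constructor <;> nlinarith [sq_nonneg (h 1 0 + h 1 1), sq_nonneg (h 1 0 - h 1 1)]
  have a2 : |(h 1 1) ^ 2 - (h 1 0) ^ 2| ≤ Dg h := by
    unfold Dg; rw [abs_le]; constructor <;> nlinarith [sq_nonneg (h 1 0), sq_nonneg (h 1 1)]
  have : Dg h * |sF h v| ≤ Dg h * (|v 0| + |v 1| + Dg h * (|v 0| + |v 1| + |v 2|)) := by
    calc Dg h * |sF h v| = |Dg h * sF h v| := by rw [abs_mul, abs_of_pos hD]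
      _ ≤ |cF h v * (h 0 0 * h 1 0 + h 0 1 * h 1 1)| + |((h 1 1) ^ 2 - (h 1 0) ^ 2) * v 0| + |(- 2 * h 1 0 * h 1 1) * v 1| := by
        rw [e, ← add_assoc]; exact abs_add_three _ _ _
      _ ≤ (Dg h * (|v 0| + |v 1| + |v 2|)) * Dg h + Dg h * |v 0| + Dg h * |v 1| := by
        rw [abs_mul _ (v 0), abs_mul _ (v 1), abs_mul (cF h v)]
        have := c_bound h v
        gcongr
      _ = _ := by ring
  exact le_of_mul_le_mul_left this hD

lemma mem_Lam' {ℓ M : ℕ} (hℓ : 0 < ℓ) {h : M2} (hh : h.det = 1) {u : V3} (hu : u ∈ Lam (ℓ * M) ℓ h) :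
    ∃ s b c : ℤ, sF h u = s ∧ bF h u = b / ℓ ∧ cF h u = c * M := by
  obtain ⟨s, b, c, hs, hb, hc⟩ := (mem_Lam hh u).1 hu
  refine ⟨s, b, c, hs, hb, ?_⟩
  have : (ℓ:ℝ) ≠ 0 := by positivity
  rw [hc]; push_cast; field_simp

lemma sqrt_mem {s m : ℝ} (h : s ^ 2 = m) : s ∈ ({√m, -√m} : Finset ℝ) := by
  rw [← h, Real.sqrt_sq_eq_abs]
  rcases abs_choice s with h | h <;> simp [h]

lemma cusp_G2 {ℓ M : ℕ} (hℓ : 0 < ℓ) {h : M2} (hh : h.det = 1)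
    (G : Finset V3) (hG : ∀ u ∈ G, u ∈ Lam (ℓ * M) ℓ h) (m : ℝ)
    (hm : ∀ u ∈ G, u 0 ^ 2 + u 1 ^ 2 - u 2 ^ 2 = m) (B : ℝ) (hB : 0 ≤ B)
    (hbox : ∀ u ∈ G, |u 2| ≤ B) (hc : ∀ u ∈ G, cF h u = 0) :
    (G.card : ℝ) ≤ 2 * (4 * ℓ * B / Dg h + 1) := by
  classical
  have hD := Dg_pos hh
  have hℓr : (0:ℝ) < ℓ := by positivity
  have hmain : (G.card : ℝ) ≤ (({√m, -√m} : Finset ℝ).card : ℝ) * (4 * ℓ * B / Dg h + 1) := by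
    apply fiber_real G (sF h)
    · intro u hu
      apply sqrt_mem
      have := quad_eq hh u
      rw [hm u hu, hc u hu] at this
      linarith
    · intro t ht
      set G' := G.filter (fun a => sF h a = t) with hG'
      have hdiff : ∀ u ∈ G', ∀ v ∈ G', 2 * u 2 / Dg h - 2 * v 2 / Dg h = bF h u - bF h v := by
        intro u hu v hv
        rw [hG', Finset.mem_filter] at hu hv
        have w1 := W_eq hh u
        have w2 := W_eq hh v
        rw [hc u hu.1, hu.2] at w1
        rw [hc v hv.1, hv.2] at w2
        change _ = bF h u * Dg h + _ - _ at w1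
        change _ = bF h v * Dg h + _ - _ at w2
        rw [w1, w2]; field_simp; ring
      have hinj : ∀ u ∈ G', ∀ v ∈ G', bF h u = bF h v → u = v := by
        intro u hu v hv huv
        rw [hG', Finset.mem_filter] at hu hv
        exact F_inj hh u v (hu.2.trans hv.2.symm) huv ((hc u hu.1).trans (hc v hv.1).symm)
      have := fiber_card G' (fun u => 2 * u 2 / Dg h) (2 * B / Dg h) (1 / ℓ) 1 (by positivity) (by positivity)
        zero_le_one ?_ ?_ ?_
      · refine this.trans (le_of_eq ?_)
        field_simp; ring
      · intro u hu
        rw [hG', Finset.mem_filter] at hu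
        have := hbox u hu.1
        rw [abs_div, abs_of_pos hD, abs_mul, abs_two]
        gcongr
      · intro u hu v hv hne
        show 1 / (ℓ:ℝ) ≤ |2 * u 2 / Dg h - 2 * v 2 / Dg h|
        rw [hdiff u hu v hv]
        have hne' : bF h u ≠ bF h v := by
          intro h0; apply hne; have := hdiff u hu v hv; rw [h0] at this; linarith
        rw [hG', Finset.mem_filter] at hu hv
        obtain ⟨s, b, c, -, hb, -⟩ := mem_Lam' hℓ hh (hG u hu.1)
        obtain ⟨s', b', c', -, hb', -⟩ := mem_Lam' hℓ hh (hG v hv.1)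
        rw [hb, hb'] at hne' ⊢
        rw [← sub_div, abs_div, abs_of_pos hℓr]
        have : b - b' ≠ 0 := by intro h0; apply hne'; rw [sub_eq_zero.1 h0]
        have := one_le_abs_int this
        push_cast at this
        gcongr
      · intro c
        have : (G'.filter (fun x => 2 * x 2 / Dg h = c)).card ≤ 1 := by
          rw [Finset.card_le_one]
          intro u hu v hv
          rw [Finset.mem_filter] at hu hv
          apply hinj u hu.1 v hv.1
          have := hdiff u hu.1 v hv.1
          rw [hu.2, hv.2] at this; linarith
        exact_mod_cast this
  refine hmain.trans ?_
  have h2 : (({√m, -√m} : Finset ℝ).card : ℝ) ≤ 2 := by exact_mod_cast Finset.card_le_two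
  gcongr

lemma cusp_G3 {ℓ M : ℕ} (hℓ : 0 < ℓ) (hM : 0 < M) {h : M2} (hh : h.det = 1)
    (G : Finset V3) (hG : ∀ u ∈ G, u ∈ Lam (ℓ * M) ℓ h) (m : ℝ)
    (hm : ∀ u ∈ G, u 0 ^ 2 + u 1 ^ 2 - u 2 ^ 2 = m) (B : ℝ) (hB : 0 ≤ B)
    (hbox : ∀ u ∈ G, |cF h u| ≤ B) (hc : ∀ u ∈ G, bF h u = 0) :
    (G.card : ℝ) ≤ 2 * (2 * B / M + 1) := by
  classical
  have hMr : (0:ℝ) < M := by positivity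
  have hmain : (G.card : ℝ) ≤ (({√m, -√m} : Finset ℝ).card : ℝ) * (2 * B / M + 1) := by
    apply fiber_real G (sF h)
    · intro u hu
      apply sqrt_mem
      have := quad_eq hh u
      rw [hm u hu, hc u hu] at this
      linarith
    · intro t ht
      set G' := G.filter (fun a => sF h a = t) with hG'
      have hinj : ∀ u ∈ G', ∀ v ∈ G', cF h u = cF h v → u = v := by
        intro u hu v hv huv
        rw [hG', Finset.mem_filter] at hu hv
        exact F_inj hh u v (hu.2.trans hv.2.symm) ((hc u hu.1).trans (hc v hv.1).symm) huv
      have := fiber_card G' (cF h) B M 1 hMr hB zero_le_one ?_ ?_ ?_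
      · rwa [one_mul] at this
      · intro u hu
        rw [hG', Finset.mem_filter] at hu
        exact hbox u hu.1
      · intro u hu v hv hne
        rw [hG', Finset.mem_filter] at hu hv
        obtain ⟨s, b, c, -, -, hb⟩ := mem_Lam' hℓ hh (hG u hu.1)
        obtain ⟨s', b', c', -, -, hb'⟩ := mem_Lam' hℓ hh (hG v hv.1)
        rw [hb, hb'] at hne ⊢
        rw [← sub_mul, abs_mul, abs_of_pos hMr]
        have : c - c' ≠ 0 := by intro h0; apply hne; rw [sub_eq_zero.1 h0]
        have := one_le_abs_int this
        push_cast at this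
        nlinarith
      · intro c
        have : (G'.filter (fun x => cF h x = c)).card ≤ 1 := by
          rw [Finset.card_le_one]
          intro u hu v hv
          rw [Finset.mem_filter] at hu hv
          exact hinj u hu.1 v hv.1 (hu.2.trans hv.2.symm)
        exact_mod_cast this
  refine hmain.trans ?_
  have h2 : (({√m, -√m} : Finset ℝ).card : ℝ) ≤ 2 := by exact_mod_cast Finset.card_le_two
  gcongr

/-- signed divisors as a finset of reals -/
def sgnDiv (k : ℕ) : Finset ℝ := (Nat.divisors k).image (fun n : ℕ => (n:ℝ)) ∪ (Nat.divisors k).image (fun n : ℕ => -(n:ℝ))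

lemma sdiv_card (k : ℕ) : ((sgnDiv k).card : ℝ) ≤ 2 * (Nat.divisors k).card := by
  unfold sgnDiv
  have h1 := Finset.card_union_le ((Nat.divisors k).image (fun n : ℕ => (n:ℝ))) ((Nat.divisors k).image (fun n : ℕ => -(n:ℝ)))
  have h2 := Finset.card_image_le (s := Nat.divisors k) (f := fun n : ℕ => (n:ℝ))
  have h3 := Finset.card_image_le (s := Nat.divisors k) (f := fun n : ℕ => -(n:ℝ))
  have h4 := h1.trans (add_le_add h2 h3)
  rw [← two_mul] at h4
  calc _ ≤ ((2 * (Nat.divisors k).card : ℕ) : ℝ) := Nat.cast_le.2 h4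
    _ = _ := by push_cast; rfl

lemma mem_sdiv {b k : ℤ} (hk : k ≠ 0) (h : b ∣ k) : (b:ℝ) ∈ sgnDiv k.natAbs := by
  have hm : b.natAbs ∈ Nat.divisors k.natAbs := by
    rw [Nat.mem_divisors]
    exact ⟨Int.natAbs_dvd_natAbs.2 h, Int.natAbs_ne_zero.2 hk⟩
  unfold sgnDiv
  rw [Finset.mem_union, Finset.mem_image, Finset.mem_image]
  rcases Int.natAbs_eq b with h | h
  · left; refine ⟨_, hm, ?_⟩
    conv_rhs => rw [h]
    simp
  · right; refine ⟨_, hm, ?_⟩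
    conv_rhs => rw [h]
    simp

lemma cusp_G1 {ℓ M : ℕ} (hℓ : 0 < ℓ) (hM : 0 < M) {h : M2} (hh : h.det = 1)
    (G : Finset V3) (hG : ∀ u ∈ G, u ∈ Lam (ℓ * M) ℓ h) (m : ℝ)
    (hm : ∀ u ∈ G, u 0 ^ 2 + u 1 ^ 2 - u 2 ^ 2 = m)
    (hs : ∀ u ∈ G, ∀ v ∈ G, ∃ k : ℤ, sF h u - sF h v = M * k) (B E Dv : ℝ) (hB : 0 ≤ B) (hDv : 0 ≤ Dv)
    (hbox : ∀ u ∈ G, |sF h u| ≤ B) (hE : |m| ≤ E) (hdiv : ∀ n : ℕ, 0 < n → (n:ℝ) ≤ ℓ * (E + B ^ 2) → ((Nat.divisors n).card : ℝ) ≤ Dv)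
    (hb0 : ∀ u ∈ G, bF h u ≠ 0) (hc0 : ∀ u ∈ G, cF h u ≠ 0) :
    (G.card : ℝ) ≤ 2 * Dv * (2 * B / M + 1) := by
  classical
  have hMr : (0:ℝ) < M := by positivity
  have hℓr : (0:ℝ) < ℓ := by positivity
  apply fiber_card G (sF h) B M (2 * Dv) hMr hB (by positivity) hbox
  · intro u hu v hv hne
    obtain ⟨k, hk⟩ := hs u hu v hv
    rw [hk, abs_mul, abs_of_pos hMr]
    have : k ≠ 0 := by rintro rfl; apply hne; simp at hk; linarith
    have := one_le_abs_int this
    nlinarith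
  · intro t
    set G' := G.filter (fun a => sF h a = t) with hG'
    rcases G'.eq_empty_or_nonempty with h0 | ⟨u0, hu0⟩
    · rw [h0]; simp; positivity
    have hu0' := hu0
    rw [hG', Finset.mem_filter] at hu0'
    obtain ⟨s0, b0, c0, hs0, hbb0, hcc0⟩ := mem_Lam' hℓ hh (hG u0 hu0'.1)
    have hprod : ∀ u ∈ G', bF h u * cF h u = m - t ^ 2 := by
      intro u hu
      rw [hG', Finset.mem_filter] at hu
      have := quad_eq hh u
      rw [hm u hu.1, hu.2] at this
      linarith
    have hk0 : b0 * c0 ≠ 0 := by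
      have e1 := hb0 u0 hu0'.1
      have e2 := hc0 u0 hu0'.1
      rw [hbb0] at e1; rw [hcc0] at e2
      apply mul_ne_zero
      · rintro rfl; simp at e1
      · rintro rfl; simp at e2
    have hsub : G'.image (fun u => ℓ * bF h u) ⊆ sgnDiv (b0 * c0).natAbs := by
      intro x hx
      obtain ⟨u, hu, rfl⟩ := Finset.mem_image.1 hx
      have hu' := hu
      rw [hG', Finset.mem_filter] at hu'
      obtain ⟨s, b, c, -, hb, hc⟩ := mem_Lam' hℓ hh (hG u hu'.1)
      have e : b * c = b0 * c0 := by
        have e1 := (hprod u hu).trans (hprod u0 hu0).symm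
        rw [hb, hc, hbb0, hcc0] at e1
        field_simp at e1
        exact_mod_cast e1
      have e2 : (ℓ:ℝ) * bF h u = (b:ℝ) := by rw [hb]; field_simp
      simp only [e2]
      exact mem_sdiv hk0 ⟨c, e.symm⟩
    have hcard : (G'.image (fun u => ℓ * bF h u)).card = G'.card := by
      apply Finset.card_image_of_injOn
      intro u hu v hv huv
      have hu' := hu
      have hv' := hv
      rw [Finset.mem_coe, hG', Finset.mem_filter] at hu' hv'
      have hb : bF h u = bF h v := mul_left_cancel₀ hℓr.ne' huv
      have p1 := hprod u hu
      rw [← hprod v hv, hb] at p1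
      exact F_inj hh u v (hu'.2.trans hv'.2.symm) hb (mul_left_cancel₀ (hb0 v hv'.1) p1)
    rw [← hcard]
    have h1 : ((G'.image (fun u => ℓ * bF h u)).card : ℝ) ≤ (sgnDiv (b0 * c0).natAbs).card := by
      exact_mod_cast Finset.card_le_card hsub
    refine h1.trans ((sdiv_card _).trans ?_)
    have h2 := hdiv (b0 * c0).natAbs (Int.natAbs_pos.2 hk0) ?_
    · linarith
    · have e1 := hprod u0 hu0
      rw [hbb0, hcc0] at e1
      have e2 : ((b0 * c0 : ℤ) : ℝ) * M = ℓ * (m - t ^ 2) := by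
        rw [← e1]; push_cast; field_simp
      have e3 : |((b0 * c0 : ℤ) : ℝ)| * M = ℓ * |m - t ^ 2| := by
        have := congrArg abs e2
        rwa [abs_mul, abs_mul, abs_of_pos hMr, abs_of_pos hℓr] at this
      rw [Nat.cast_natAbs, Int.cast_abs]
      have hM1 : (1:ℝ) ≤ M := by exact_mod_cast hM
      have ht : t ^ 2 ≤ B ^ 2 := by
        have := hbox u0 hu0'.1
        rw [hu0'.2] at this
        rw [← sq_abs]; gcongr
      have h4 : |m - t ^ 2| ≤ E + B ^ 2 := by
        refine (abs_sub _ _).trans ?_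
        rw [abs_of_nonneg (sq_nonneg t)]; linarith
      calc |((b0 * c0 : ℤ) : ℝ)| ≤ |((b0 * c0 : ℤ) : ℝ)| * M := le_mul_of_one_le_right (abs_nonneg _) hM1
        _ = ℓ * |m - t ^ 2| := e3
        _ ≤ _ := by gcongr

lemma r_cusp {ℓ M : ℕ} (hℓ : 0 < ℓ) (hM : 0 < M) (hsq : Squarefree (ℓ * M)) {g : M2} (hg : g.det = 1)
    (F : Finset V3) (hF : ∀ u ∈ F, u ∈ Lam (ℓ * M) ℓ g) (m : ℝ)
    (hm : ∀ u ∈ F, u 0 ^ 2 + u 1 ^ 2 - u 2 ^ 2 = m) (L d Dv : ℝ) (hL : 1 / 2 ≤ L) (hd : 0 < d) (hd1 : d ≤ 1)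
    (hHL : 1 ≤ Hgt (ℓ * M) g * L) (hDv : 1 ≤ Dv)
    (hdiv : ∀ n : ℕ, 0 < n → (n:ℝ) ≤ ℓ * (8 * L ^ 2 + (20 * L ^ 2) ^ 2) → ((Nat.divisors n).card : ℝ) ≤ Dv)
    (hbox : ∀ u ∈ F, |u 0| ≤ 2 * L ∧ |u 1| ≤ 2 * L ∧ |u 2| ≤ d * (2 * L)) :
    (F.card : ℝ) ≤ (Nat.divisors M).card * (128 * Dv * (1 + L ^ 2 / M + ℓ * Hgt (ℓ * M) g * d * L)) := by
  classical
  have hN : 0 < ℓ * M := Nat.mul_pos hℓ hM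
  have hH := Hgt_pos hN hg
  obtain ⟨h, hh, hLam, hD2, hD1, hx⟩ := exists_good hℓ hM hg (ℓ := ℓ) (M := M)
  set H := Hgt (ℓ * M) g with hHdef
  have hD := Dg_pos hh
  have hℓr : (0:ℝ) < ℓ := by positivity
  have hMr : (0:ℝ) < M := by positivity
  have hL0 : 0 < L := by linarith
  have hDL : Dg h ≤ 2 * L := by nlinarith
  have hDi : 1 / Dg h ≤ H := by rw [div_le_iff₀ hD]; exact hD1
  have hW : ∀ u ∈ F, |u 2| ≤ 2 * L := by
    intro u hu
    have := (hbox u hu).2.2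
    nlinarith
  have hcb : ∀ u ∈ F, |cF h u| ≤ 12 * L ^ 2 := by
    intro u hu
    obtain ⟨b0, b1, -⟩ := hbox u hu
    have b2 := hW u hu
    calc |cF h u| ≤ Dg h * (|u 0| + |u 1| + |u 2|) := c_bound h u
      _ ≤ (2 * L) * (2 * L + 2 * L + 2 * L) := by gcongr
      _ = _ := by ring
  have hsb : ∀ u ∈ F, |sF h u| ≤ 20 * L ^ 2 := by
    intro u hu
    obtain ⟨b0, b1, -⟩ := hbox u hu
    have b2 := hW u hu
    calc |sF h u| ≤ |u 0| + |u 1| + Dg h * (|u 0| + |u 1| + |u 2|) := s_bound hh u hx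
      _ ≤ 2 * L + 2 * L + (2 * L) * (2 * L + 2 * L + 2 * L) := by gcongr
      _ ≤ _ := by nlinarith
  rcases F.eq_empty_or_nonempty with rfl | ⟨u0, hu0⟩
  · simp; positivity
  have hmE : |m| ≤ 8 * L ^ 2 := by
    rw [← hm u0 hu0]
    obtain ⟨b0, b1, -⟩ := hbox u0 hu0
    have b2 := hW u0 hu0
    have s0 : (u0 0) ^ 2 ≤ (2 * L) ^ 2 := by rw [← sq_abs]; gcongr
    have s1 : (u0 1) ^ 2 ≤ (2 * L) ^ 2 := by rw [← sq_abs]; gcongr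
    have s2 : (u0 2) ^ 2 ≤ (2 * L) ^ 2 := by rw [← sq_abs]; gcongr
    rw [abs_le]
    constructor <;> nlinarith [sq_nonneg (u0 0), sq_nonneg (u0 1), sq_nonneg (u0 2)]
  apply class_card hℓ hM hsq hh F (fun u hu => hLam u (hF u hu)) m hm _ (by positivity)
  intro G hGF hs
  have hsub : G ⊆ (G.filter (fun u => cF h u = 0) ∪ G.filter (fun u => bF h u = 0)) ∪
      G.filter (fun u => bF h u ≠ 0 ∧ cF h u ≠ 0) := by
    intro u hu
    simp only [Finset.mem_union, Finset.mem_filter]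
    tauto
  have g2 := cusp_G2 (M := M) hℓ hh (G.filter (fun u => cF h u = 0))
    (fun u hu => hLam u (hF u (hGF (Finset.mem_filter.1 hu).1))) m
    (fun u hu => hm u (hGF (Finset.mem_filter.1 hu).1)) (d * (2 * L)) (by positivity)
    (fun u hu => (hbox u (hGF (Finset.mem_filter.1 hu).1)).2.2) (fun u hu => (Finset.mem_filter.1 hu).2)
  have g3 := cusp_G3 hℓ hM hh (G.filter (fun u => bF h u = 0))
    (fun u hu => hLam u (hF u (hGF (Finset.mem_filter.1 hu).1))) m
    (fun u hu => hm u (hGF (Finset.mem_filter.1 hu).1)) (12 * L ^ 2) (by positivity)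
    (fun u hu => hcb u (hGF (Finset.mem_filter.1 hu).1)) (fun u hu => (Finset.mem_filter.1 hu).2)
  have g1 := cusp_G1 hℓ hM hh (G.filter (fun u => bF h u ≠ 0 ∧ cF h u ≠ 0))
    (fun u hu => hLam u (hF u (hGF (Finset.mem_filter.1 hu).1))) m
    (fun u hu => hm u (hGF (Finset.mem_filter.1 hu).1))
    (fun u hu v hv => hs u (Finset.mem_filter.1 hu).1 v (Finset.mem_filter.1 hv).1)
    (20 * L ^ 2) (8 * L ^ 2) Dv (by positivity) (by linarith)
    (fun u hu => hsb u (hGF (Finset.mem_filter.1 hu).1)) hmE hdiv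
    (fun u hu => (Finset.mem_filter.1 hu).2.1) (fun u hu => (Finset.mem_filter.1 hu).2.2)
  have hc : (G.card : ℝ) ≤ (G.filter (fun u => cF h u = 0)).card + (G.filter (fun u => bF h u = 0)).card +
      (G.filter (fun u => bF h u ≠ 0 ∧ cF h u ≠ 0)).card := by
    have a1 := Finset.card_le_card hsub
    have a2 := Finset.card_union_le (G.filter (fun u => cF h u = 0) ∪ G.filter (fun u => bF h u = 0)) (G.filter (fun u => bF h u ≠ 0 ∧ cF h u ≠ 0))
    have a3 := Finset.card_union_le (G.filter (fun u => cF h u = 0)) (G.filter (fun u => bF h u = 0))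
    exact_mod_cast (a1.trans a2).trans (Nat.add_le_add_right a3 _)
  have e2 : 4 * ℓ * (d * (2 * L)) / Dg h ≤ 8 * (ℓ * H * d * L) := by
    calc 4 * ℓ * (d * (2 * L)) / Dg h = 8 * ℓ * d * L * (1 / Dg h) := by ring
      _ ≤ 8 * ℓ * d * L * H := by gcongr
      _ = _ := by ring
  set x := L ^ 2 / M with hxd
  set y := ℓ * H * d * L with hyd
  have hx0 : 0 ≤ x := by positivity
  have hy0 : 0 ≤ y := by positivity
  have e3 : 2 * (12 * L ^ 2) / M = 24 * x := by rw [hxd]; ring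
  have e1 : 2 * (20 * L ^ 2) / M = 40 * x := by rw [hxd]; ring
  rw [e3] at g3
  rw [e1] at g1
  have m1 : x ≤ Dv * x := le_mul_of_one_le_left hx0 hDv
  have m2 : y ≤ Dv * y := le_mul_of_one_le_left hy0 hDv
  linarith

lemma r_dual {ℓ M : ℕ} (hℓ : 0 < ℓ) (hM : 0 < M) (hsq : Squarefree (ℓ * M)) {g : M2} (hg : g.det = 1)
    (F : Finset V3) (hF : ∀ u ∈ F, u ∈ Lam (ℓ * M) ℓ g) (m : ℝ)
    (hm : ∀ u ∈ F, u 0 ^ 2 + u 1 ^ 2 - u 2 ^ 2 = m) (A d : ℝ) (hA : 0 < A) (hd : 0 < d) (hd1 : d ≤ 1)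
    (hbox : ∀ u ∈ F, |u 0| ≤ A ∧ |u 1| ≤ A ∧ |u 2| ≤ d * A) :
    (F.card : ℝ) ≤ (Nat.divisors M).card * (2400 * (1 + √(ℓ * M : ℝ) * (A / M) + ℓ * Hgt (ℓ * M) g * d * A + ℓ * M * (A / M) ^ 2 +
      ℓ * M * Hgt (ℓ * M) g * d * (A / M) ^ 2 + ℓ * M * d * (A / M) ^ 3)) := by
  have hN : 0 < ℓ * M := Nat.mul_pos hℓ hM
  have hH := Hgt_pos hN hg
  have hℓr : (0:ℝ) < ℓ := by positivity
  have hMr : (0:ℝ) < M := by positivity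
  apply class_card hℓ hM hsq hg F hF m hm _ (by positivity)
  intro G hGF hs
  exact r_class hℓ hM hsq hg G (fun u hu => hF u (hGF hu)) hs A d hA hd hd1 (fun u hu => hbox u (hGF hu))

/-- the bracket of the statement, in terms of q = √ℓ, r = 1/√M -/
def Xb (q r H d L : ℝ) : ℝ := 1 + q * H * d + q * r * L + q ^ 2 * H * d * L + q ^ 2 * r ^ 2 * d * L ^ 2

lemma Xb_ge {q r H d L : ℝ} (hq : 1 ≤ q) (hr : 0 < r) (hH : 0 < H) (hd : 0 < d) (hL : 0 < L) :
    1 ≤ Xb q r H d L ∧ q * H * d ≤ Xb q r H d L ∧ q * r * L ≤ Xb q r H d L ∧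
    q ^ 2 * H * d * L ≤ Xb q r H d L ∧ q ^ 2 * r ^ 2 * d * L ^ 2 ≤ Xb q r H d L := by
  have h1 : 0 < q * H * d := by positivity
  have h2 : 0 < q * r * L := by positivity
  have h3 : 0 < q ^ 2 * H * d * L := by positivity
  have h4 : 0 < q ^ 2 * r ^ 2 * d * L ^ 2 := by positivity
  unfold Xb
  refine ⟨?_, ?_, ?_, ?_, ?_⟩ <;> linarith

lemma T_ineq {q r H d L : ℝ} (hq : 1 ≤ q) (hr : 0 < r) (hH : 0 < H) (hd : 0 < d) (hL : 0 < L)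
    (h4 : 1 ≤ 4 * (q * L * Xb q r H d L)) :
    1 + q * (2 * L) + q ^ 2 * H * d * (2 * L) + q ^ 2 * r * (2 * L) ^ 2 + q ^ 2 * H * d * (2 * L) ^ 2
      + q ^ 2 * r ^ 2 * d * (2 * L) ^ 3 ≤ 12 * (q * L * Xb q r H d L) := by
  have e1 : 0 ≤ (q - 1) * (q ^ 2 * H * d * L ^ 2) := mul_nonneg (by linarith) (by positivity)
  have e2 : 0 ≤ (q - 1) * (q ^ 2 * r ^ 2 * d * L ^ 3) := mul_nonneg (by linarith) (by positivity)
  have e3 : 0 < q ^ 2 * H * d * L := by positivity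
  have e4 : 0 < q ^ 2 * r * L ^ 2 := by positivity
  have e5 : 0 < q ^ 2 * H * d * L ^ 2 := by positivity
  have e6 : 0 < q ^ 2 * r ^ 2 * d * L ^ 3 := by positivity
  have e7 : 0 < q * L := by positivity
  unfold Xb at *
  nlinarith

set_option maxHeartbeats 1600000 in
lemma claimB {q p r H d L T R D1 Dv : ℝ} (hq : 1 ≤ q) (hp : 1 ≤ p) (hpr : p * r = 1) (hH : 0 < H)
    (hNH : 1 ≤ 2 * (q ^ 2 * p ^ 2) * H) (hd : 0 < d) (hd1 : d ≤ 1)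
    (hdL : 1 ≤ 2 * (d * L)) (hT0 : 0 ≤ T) (hR0 : 0 ≤ R)
    (hT : T ≤ 2400 * (1 + q * (2 * L) + q ^ 2 * H * d * (2 * L) + q ^ 2 * r * (2 * L) ^ 2 + q ^ 2 * H * d * (2 * L) ^ 2
      + q ^ 2 * r ^ 2 * d * (2 * L) ^ 3))
    (hT2 : T ≤ 28800 * (q * L * Xb q r H d L))
    (hD1 : 1 ≤ D1) (hDv : 1 ≤ Dv)
    (hR1 : H * L ≤ 1 → R ≤ D1 * (2400 * (1 + 2 * q * r * L + 2 * q ^ 2 * H * d * L + 4 * q ^ 2 * r ^ 2 * L ^ 2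
      + 4 * q ^ 2 * r ^ 2 * H * d * L ^ 2 + 8 * q ^ 2 * r ^ 4 * d * L ^ 3)))
    (hR2 : 1 ≤ H * L → R ≤ D1 * (128 * Dv * (1 + r ^ 2 * L ^ 2 + q ^ 2 * H * d * L))) :
    d * L * T * R ≤ 10 ^ 11 * (D1 * Dv) * (q ^ 2 * L ^ 2 * Xb q r H d L ^ 2) := by
  have hL : 1 / 2 ≤ L := by nlinarith
  have hL0 : 0 < L := by linarith
  have hp0 : 0 < p := by linarith
  have hr : 0 < r := by
    by_contra h
    nlinarith
  have hr1 : r ≤ 1 := by nlinarith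
  obtain ⟨x1, x2, x3, x4, x5⟩ := Xb_ge hq hr hH hd hL0
  set X := Xb q r H d L with hX
  have hX0 : 0 < X := by linarith
  have hq2 : q ≤ q ^ 2 := by nlinarith
  have hmain : 0 ≤ q ^ 2 * L ^ 2 * X ^ 2 := by positivity
  -- generic step
  have step : ∀ S c : ℝ, 0 ≤ S → d * S ≤ c * X → 0 ≤ c →
      d * L * T * S ≤ 28800 * c * (q ^ 2 * L ^ 2 * X ^ 2) := by
    intro S c hS hc hc0
    calc d * L * T * S = L * T * (d * S) := by ring
      _ ≤ L * (28800 * (q * L * X)) * (c * X) := by gcongr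
      _ = 28800 * c * (q * (L ^ 2 * X ^ 2)) := by ring
      _ ≤ 28800 * c * (q ^ 2 * (L ^ 2 * X ^ 2)) := by gcongr
      _ = _ := by ring
  rcases le_total (H * L) 1 with hHL | hHL
  · have hR := hR1 hHL
    have dm : ∀ y : ℝ, 0 ≤ y → d * y ≤ y := fun y hy => by nlinarith
    have a2 : d * (2 * q * r * L) ≤ 2 * X := (dm _ (by positivity)).trans (by linarith)
    have a3 : d * (2 * q ^ 2 * H * d * L) ≤ 2 * X := (dm _ (by positivity)).trans (by linarith)
    have a4 : d * (4 * q ^ 2 * r ^ 2 * L ^ 2) ≤ 4 * X := by linarith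
    have a5 : d * (4 * q ^ 2 * r ^ 2 * H * d * L ^ 2) ≤ 8 * X := by
      have : 4 * q ^ 2 * r ^ 2 * H * d * L ^ 2 ≤ 8 * (q ^ 2 * r ^ 2 * d * L ^ 2) := by
        calc 4 * q ^ 2 * r ^ 2 * H * d * L ^ 2 = 4 * (q ^ 2 * r ^ 2 * d) * L * (H * L) := by ring
          _ ≤ 4 * (q ^ 2 * r ^ 2 * d) * L * (2 * L) := mul_le_mul_of_nonneg_left (by linarith) (by positivity)
          _ = _ := by ring
      exact (dm _ (by positivity)).trans (by linarith)
    have s1 := step (1 + 2 * q * r * L + 2 * q ^ 2 * H * d * L + 4 * q ^ 2 * r ^ 2 * L ^ 2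
      + 4 * q ^ 2 * r ^ 2 * H * d * L ^ 2) 17 (by positivity) (by linarith) (by norm_num)
    have hTq : T ≤ 2400 * 44 * (q ^ 4 * L ^ 2) := by
      refine hT.trans ?_
      have hq4 : q ^ 2 ≤ q ^ 4 := pow_le_pow_right₀ hq (by norm_num)
      have hq1 : q ≤ q ^ 4 := by linarith
      have hL4 : L ≤ 2 * L ^ 2 := by nlinarith
      have hLb : L ≤ 2 * (q ^ 2 * p ^ 2) := by
        calc L = L * 1 := by ring
          _ ≤ L * (2 * (q ^ 2 * p ^ 2) * H) := by gcongr
          _ = 2 * (q ^ 2 * p ^ 2) * (H * L) := by ring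
          _ ≤ 2 * (q ^ 2 * p ^ 2) * 1 := by gcongr
          _ = _ := by ring
      have b1 : 1 ≤ 4 * (q ^ 4 * L ^ 2) := by
        have h1 : 1 ≤ q ^ 4 := one_le_pow₀ hq
        calc (1:ℝ) ≤ 1 * (4 * L ^ 2) := by nlinarith only [hL]
          _ ≤ q ^ 4 * (4 * L ^ 2) := by gcongr
          _ = _ := by ring
      have b2 : q * (2 * L) ≤ 4 * (q ^ 4 * L ^ 2) := by
        calc q * (2 * L) ≤ q ^ 4 * (2 * (2 * L ^ 2)) := by gcongr
          _ = _ := by ring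
      have b3 : q ^ 2 * H * d * (2 * L) ≤ 8 * (q ^ 4 * L ^ 2) := by
        calc q ^ 2 * H * d * (2 * L) = q ^ 2 * 2 * (H * L) * d := by ring
          _ ≤ q ^ 4 * 2 * 1 * 1 := by gcongr
          _ = q ^ 4 * 2 := by ring
          _ ≤ q ^ 4 * (8 * L ^ 2) := by gcongr; nlinarith only [hL]
          _ = _ := by ring
      have b4 : q ^ 2 * r * (2 * L) ^ 2 ≤ 4 * (q ^ 4 * L ^ 2) := by
        calc q ^ 2 * r * (2 * L) ^ 2 ≤ q ^ 4 * 1 * (2 * L) ^ 2 := by gcongr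
          _ = _ := by ring
      have b5 : q ^ 2 * H * d * (2 * L) ^ 2 ≤ 8 * (q ^ 4 * L ^ 2) := by
        calc q ^ 2 * H * d * (2 * L) ^ 2 = 4 * q ^ 2 * d * (H * L) * L := by ring
          _ ≤ 4 * q ^ 4 * 1 * 1 * (2 * L ^ 2) := by gcongr
          _ = _ := by ring
      have b6 : q ^ 2 * r ^ 2 * d * (2 * L) ^ 3 ≤ 16 * (q ^ 4 * L ^ 2) := by
        calc q ^ 2 * r ^ 2 * d * (2 * L) ^ 3 = 8 * q ^ 2 * r ^ 2 * d * L ^ 2 * L := by ring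
          _ ≤ 8 * q ^ 2 * r ^ 2 * 1 * L ^ 2 * (2 * (q ^ 2 * p ^ 2)) := by gcongr
          _ = 16 * (q ^ 4 * L ^ 2) * (p * r) ^ 2 := by ring
          _ = _ := by rw [hpr]; ring
      linarith
    have s2 : d * L * T * (8 * q ^ 2 * r ^ 4 * d * L ^ 3) ≤ 844800 * (q ^ 2 * L ^ 2 * X ^ 2) := by
      calc d * L * T * (8 * q ^ 2 * r ^ 4 * d * L ^ 3)
          ≤ d * L * (2400 * 44 * (q ^ 4 * L ^ 2)) * (8 * q ^ 2 * r ^ 4 * d * L ^ 3) := by gcongr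
        _ = 844800 * (q ^ 2 * L ^ 2 * (q ^ 2 * r ^ 2 * d * L ^ 2) ^ 2) := by ring
        _ ≤ _ := by gcongr
    have hD : 0 ≤ (D1 * (Dv - 1)) * (q ^ 2 * L ^ 2 * X ^ 2) :=
      mul_nonneg (mul_nonneg (by linarith) (by linarith)) hmain
    calc d * L * T * R ≤ d * L * T * (D1 * (2400 * (1 + 2 * q * r * L + 2 * q ^ 2 * H * d * L + 4 * q ^ 2 * r ^ 2 * L ^ 2
      + 4 * q ^ 2 * r ^ 2 * H * d * L ^ 2 + 8 * q ^ 2 * r ^ 4 * d * L ^ 3))) := by gcongr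
      _ = D1 * 2400 * (d * L * T * (1 + 2 * q * r * L + 2 * q ^ 2 * H * d * L + 4 * q ^ 2 * r ^ 2 * L ^ 2
      + 4 * q ^ 2 * r ^ 2 * H * d * L ^ 2) + d * L * T * (8 * q ^ 2 * r ^ 4 * d * L ^ 3)) := by ring
      _ ≤ D1 * 2400 * (28800 * 17 * (q ^ 2 * L ^ 2 * X ^ 2) + 844800 * (q ^ 2 * L ^ 2 * X ^ 2)) := by gcongr
      _ = 3202560000 * D1 * (q ^ 2 * L ^ 2 * X ^ 2) := by ring
      _ ≤ 10 ^ 11 * D1 * (q ^ 2 * L ^ 2 * X ^ 2) := by gcongr; norm_num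
      _ ≤ _ := by linarith only [hD]
  · have hR := hR2 hHL
    have a1 : d * (1 + r ^ 2 * L ^ 2 + q ^ 2 * H * d * L) ≤ 3 * X := by
      have u1 : d * (r ^ 2 * L ^ 2) ≤ q ^ 2 * r ^ 2 * d * L ^ 2 := by
        calc d * (r ^ 2 * L ^ 2) = 1 * (r ^ 2 * d * L ^ 2) := by ring
          _ ≤ q ^ 2 * (r ^ 2 * d * L ^ 2) := by gcongr; nlinarith
          _ = _ := by ring
      have u2 : d * (q ^ 2 * H * d * L) ≤ q ^ 2 * H * d * L := by
        have : 0 ≤ q ^ 2 * H * d * L := by positivity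
        nlinarith
      linarith
    have s1 := step (1 + r ^ 2 * L ^ 2 + q ^ 2 * H * d * L) 3 (by positivity) a1 (by norm_num)
    calc d * L * T * R ≤ d * L * T * (D1 * (128 * Dv * (1 + r ^ 2 * L ^ 2 + q ^ 2 * H * d * L))) := by gcongr
      _ = 128 * (D1 * Dv) * (d * L * T * (1 + r ^ 2 * L ^ 2 + q ^ 2 * H * d * L)) := by ring
      _ ≤ 128 * (D1 * Dv) * (28800 * 3 * (q ^ 2 * L ^ 2 * X ^ 2)) := by gcongr
      _ = 11059200 * (D1 * Dv) * (q ^ 2 * L ^ 2 * X ^ 2) := by ring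
      _ ≤ _ := by gcongr; norm_num

lemma pq_i {α : Type*} [DecidableEq α] (U : Finset α) (Tt : Finset ℤ) (Q : α → ℝ) (Dv : ℝ) (hDv0 : 0 ≤ Dv)
    (hdiv : ∀ t1 ∈ Tt, ∀ t2 ∈ Tt, t1 ^ 2 - t2 ^ 2 ≠ 0 → ((Nat.divisors (t1 ^ 2 - t2 ^ 2).natAbs).card : ℝ) ≤ Dv)
    (F : Finset ((ℤ × α) × (ℤ × α)))
    (hF : ∀ p ∈ F, p.1.1 ∈ Tt ∧ p.1.2 ∈ U ∧ p.2.1 ∈ Tt ∧ p.2.2 ∈ U ∧ p.1.1 ^ 2 - p.2.1 ^ 2 ≠ 0 ∧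
      ((p.1.1 : ℝ)) ^ 2 - Q p.1.2 = (p.2.1 : ℝ) ^ 2 - Q p.2.2) :
    (F.card : ℝ) ≤ (U.card * U.card : ℝ) * (2 * Dv) := by
  have key := fiber_real F (fun p => (p.1.2, p.2.2)) (U ×ˢ U) (2 * Dv)
    (fun p hp => Finset.mk_mem_product (hF p hp).2.1 (hF p hp).2.2.2.1) ?_
  · rw [Finset.card_product] at key; push_cast at key; exact key
  rintro ⟨u1, u2⟩ _
  set G := F.filter (fun p => (p.1.2, p.2.2) = (u1, u2)) with hG
  rcases G.eq_empty_or_nonempty with h0 | ⟨p0, hp0⟩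
  · rw [h0]; simp; linarith
  have hmem : ∀ p ∈ G, p ∈ F ∧ p.1.2 = u1 ∧ p.2.2 = u2 := by
    intro p hp
    rw [hG, Finset.mem_filter, Prod.mk.injEq] at hp
    exact ⟨hp.1, hp.2.1, hp.2.2⟩
  obtain ⟨a1, a2, a3, a4, a5, a6⟩ := hF p0 (hmem p0 hp0).1
  set k : ℤ := p0.1.1 ^ 2 - p0.2.1 ^ 2 with hk
  have hkp : ∀ p ∈ G, p.1.1 ^ 2 - p.2.1 ^ 2 = k := by
    intro p hp
    obtain ⟨b1, b2, b3, b4, b5, b6⟩ := hF p (hmem p hp).1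
    rw [(hmem p hp).2.1, (hmem p hp).2.2] at b6
    rw [(hmem p0 hp0).2.1, (hmem p0 hp0).2.2] at a6
    have : ((p.1.1 ^ 2 - p.2.1 ^ 2 : ℤ) : ℝ) = ((p0.1.1 ^ 2 - p0.2.1 ^ 2 : ℤ) : ℝ) := by
      push_cast; linarith
    exact_mod_cast this
  have hc : G.card ≤ (sgnDiv k.natAbs).card := by
    apply Finset.card_le_card_of_injOn (fun p => ((p.1.1 - p.2.1 : ℤ) : ℝ))
    · intro p hp
      have h1 := hkp p hp
      exact mem_sdiv a5 ⟨p.1.1 + p.2.1, by rw [← h1]; ring⟩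
    · intro p hp p' hp' he
      have h1 := hkp p hp
      have h2 := hkp p' hp'
      have he' : p.1.1 - p.2.1 = p'.1.1 - p'.2.1 := by
        have he2 : ((p.1.1 - p.2.1 : ℤ) : ℝ) = ((p'.1.1 - p'.2.1 : ℤ) : ℝ) := he
        exact_mod_cast he2
      have hne : p.1.1 - p.2.1 ≠ 0 := by
        intro h
        apply a5
        rw [← h1]
        have : p.1.1 ^ 2 - p.2.1 ^ 2 = (p.1.1 - p.2.1) * (p.1.1 + p.2.1) := by ring
        rw [this, h, zero_mul]
      have hs : p.1.1 + p.2.1 = p'.1.1 + p'.2.1 := by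
        apply mul_left_cancel₀ hne
        calc (p.1.1 - p.2.1) * (p.1.1 + p.2.1) = k := by rw [← h1]; ring
          _ = (p'.1.1 - p'.2.1) * (p'.1.1 + p'.2.1) := by rw [← h2]; ring
          _ = _ := by rw [he']
      have m1 := hmem p hp
      have m2 := hmem p' hp'
      refine Prod.ext (Prod.ext ?_ ?_) (Prod.ext ?_ ?_)
      · omega
      · rw [m1.2.1, m2.2.1]
      · omega
      · rw [m1.2.2, m2.2.2]
  calc (G.card : ℝ) ≤ (sgnDiv k.natAbs).card := by exact_mod_cast hc
    _ ≤ 2 * (Nat.divisors k.natAbs).card := sdiv_card _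
    _ ≤ 2 * Dv := by
      have := hdiv _ a1 _ a3 a5
      linarith

lemma pq_iii {α : Type*} [DecidableEq α] (U : Finset α) (Tt : Finset ℤ) (Q : α → ℝ) (R : ℝ)
    (hR : ∀ m : ℝ, ((U.filter (fun u => Q u = m)).card : ℝ) ≤ R)
    (F : Finset ((ℤ × α) × (ℤ × α)))
    (hF : ∀ p ∈ F, p.1.1 ∈ Tt ∧ p.1.2 ∈ U ∧ p.2.1 ∈ Tt ∧ p.2.2 ∈ U ∧ p.1.1 ^ 2 - p.2.1 ^ 2 = 0 ∧
      ((p.1.1 : ℝ)) ^ 2 - Q p.1.2 = (p.2.1 : ℝ) ^ 2 - Q p.2.2) :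
    (F.card : ℝ) ≤ (Tt.card * U.card : ℝ) * (2 * R) := by
  have key := fiber_real F (fun p => p.1) (Tt ×ˢ U) (2 * R)
    (fun p hp => Finset.mem_product.2 ⟨(hF p hp).1, (hF p hp).2.1⟩) ?_
  · rw [Finset.card_product] at key; push_cast at key; exact key
  rintro ⟨t, u⟩ _
  set G := F.filter (fun p => p.1 = (t, u)) with hG
  have hc : G.card ≤ (({t, -t} : Finset ℤ) ×ˢ (U.filter (fun v => Q v = Q u))).card := by
    apply Finset.card_le_card_of_injOn (fun p => p.2)
    · intro p hp
      rw [hG, Finset.mem_coe, Finset.mem_filter] at hp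
      obtain ⟨b1, b2, b3, b4, b5, b6⟩ := hF p hp.1
      rw [hp.2] at b5 b6
      have h2 : p.2.1 ^ 2 = t ^ 2 := by
        have : t ^ 2 - p.2.1 ^ 2 = 0 := b5
        linarith
      have h2r : (p.2.1 : ℝ) ^ 2 = (t : ℝ) ^ 2 := by exact_mod_cast h2
      have h3 : (t:ℝ) ^ 2 - Q u = (p.2.1 : ℝ) ^ 2 - Q p.2.2 := b6
      refine Finset.mem_coe.2 (Finset.mem_product.2 ⟨?_, ?_⟩)
      · rcases sq_eq_sq_iff_eq_or_eq_neg.1 h2 with h | h <;> simp [h]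
      · exact Finset.mem_filter.2 ⟨b4, by linarith⟩
    · intro p hp p' hp' he
      rw [hG, Finset.mem_coe, Finset.mem_filter] at hp hp'
      exact Prod.ext (hp.2.trans hp'.2.symm) he
  rw [Finset.card_product] at hc
  have h2 : ({t, -t} : Finset ℤ).card ≤ 2 := Finset.card_le_two
  have hR' := hR (Q u)
  calc (G.card : ℝ) ≤ ((({t, -t} : Finset ℤ).card * (U.filter (fun v => Q v = Q u)).card : ℕ) : ℝ) := by exact_mod_cast hc
    _ = (({t, -t} : Finset ℤ).card : ℝ) * ((U.filter (fun v => Q v = Q u)).card : ℝ) := by push_cast; rfl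
    _ ≤ 2 * R := by
      apply mul_le_mul _ hR' (by positivity) (by norm_num)
      exact_mod_cast h2

lemma pq_card {α : Type*} [DecidableEq α] (U : Finset α) (Tt : Finset ℤ) (Q : α → ℝ) (R Dv : ℝ) (hDv0 : 0 ≤ Dv)
    (hR : ∀ m : ℝ, ((U.filter (fun u => Q u = m)).card : ℝ) ≤ R)
    (hdiv : ∀ t1 ∈ Tt, ∀ t2 ∈ Tt, t1 ^ 2 - t2 ^ 2 ≠ 0 → ((Nat.divisors (t1 ^ 2 - t2 ^ 2).natAbs).card : ℝ) ≤ Dv)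
    (F : Finset ((ℤ × α) × (ℤ × α)))
    (hF : ∀ p ∈ F, p.1.1 ∈ Tt ∧ p.1.2 ∈ U ∧ p.2.1 ∈ Tt ∧ p.2.2 ∈ U ∧
      ((p.1.1 : ℝ)) ^ 2 - Q p.1.2 = (p.2.1 : ℝ) ^ 2 - Q p.2.2) :
    (F.card : ℝ) ≤ (U.card * U.card : ℝ) * (2 * Dv) + (U.card * U.card : ℝ)
      + ((Tt.filter (fun t => t ≠ 0)).card * U.card : ℝ) * (2 * R) := by
  have h1 := pq_i U Tt Q Dv hDv0 hdiv (F.filter (fun p => p.1.1 ^ 2 - p.2.1 ^ 2 ≠ 0)) (by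
    intro p hp
    rw [Finset.mem_filter] at hp
    obtain ⟨a, b, c, d, e⟩ := hF p hp.1
    exact ⟨a, b, c, d, hp.2, e⟩)
  set F2 := F.filter (fun p => ¬ (p.1.1 ^ 2 - p.2.1 ^ 2 ≠ 0)) with hF2
  have e1 : (F.filter (fun p => p.1.1 ^ 2 - p.2.1 ^ 2 ≠ 0)).card + F2.card = F.card :=
    Finset.card_filter_add_card_filter_not _
  have e2 : (F2.filter (fun p => p.1.1 ≠ 0)).card + (F2.filter (fun p => ¬ (p.1.1 ≠ 0))).card = F2.card :=
    Finset.card_filter_add_card_filter_not _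
  have h3 := pq_iii U (Tt.filter (fun t => t ≠ 0)) Q R hR (F2.filter (fun p => p.1.1 ≠ 0)) (by
    intro p hp
    rw [Finset.mem_filter, hF2, Finset.mem_filter, not_not] at hp
    obtain ⟨⟨hp1, hp2⟩, hp3⟩ := hp
    obtain ⟨a, b, c, d, e⟩ := hF p hp1
    refine ⟨Finset.mem_filter.2 ⟨a, hp3⟩, b, Finset.mem_filter.2 ⟨c, ?_⟩, d, hp2, e⟩
    intro h
    rw [h] at hp2
    apply hp3
    have : p.1.1 ^ 2 = 0 := by linarith
    exact pow_eq_zero_iff (two_ne_zero) |>.1 this)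
  have h2 : (F2.filter (fun p => ¬ (p.1.1 ≠ 0))).card ≤ (U ×ˢ U).card := by
    have hz : ∀ p ∈ F2.filter (fun p => ¬ (p.1.1 ≠ 0)), p ∈ F ∧ p.1.1 = 0 ∧ p.2.1 = 0 := by
      intro p hp
      rw [Finset.mem_filter, hF2, Finset.mem_filter, not_not, not_not] at hp
      obtain ⟨⟨hp1, hp2⟩, hp3⟩ := hp
      refine ⟨hp1, hp3, ?_⟩
      rw [hp3] at hp2
      have : p.2.1 ^ 2 = 0 := by linarith
      exact pow_eq_zero_iff (two_ne_zero) |>.1 this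
    apply Finset.card_le_card_of_injOn (fun p => (p.1.2, p.2.2))
    · intro p hp
      obtain ⟨a, b, c, d, e⟩ := hF p (hz p hp).1
      exact Finset.mem_coe.2 (Finset.mem_product.2 ⟨b, d⟩)
    · intro p hp p' hp' he
      obtain ⟨he1, he2⟩ := Prod.mk.inj he
      exact Prod.ext (Prod.ext ((hz p hp).2.1.trans (hz p' hp').2.1.symm) he1)
        (Prod.ext ((hz p hp).2.2.trans (hz p' hp').2.2.symm) he2)
  rw [Finset.card_product] at h2
  have h2r : ((F2.filter (fun p => ¬ (p.1.1 ≠ 0))).card : ℝ) ≤ (U.card * U.card : ℝ) := by exact_mod_cast h2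
  have e1r : ((F.filter (fun p => p.1.1 ^ 2 - p.2.1 ^ 2 ≠ 0)).card : ℝ) + F2.card = F.card := by exact_mod_cast e1
  have e2r : ((F2.filter (fun p => p.1.1 ≠ 0)).card : ℝ) + (F2.filter (fun p => ¬ (p.1.1 ≠ 0))).card = F2.card := by
    exact_mod_cast e2
  linarith

/-- integral trace and traceless coordinates -/
def phi (γ : M2) : ℤ × V3 := (⌊γ 0 0 + γ 1 1⌋, ![γ 0 0 - γ 1 1, γ 0 1 + γ 1 0, γ 0 1 - γ 1 0])

lemma trace_int {N ℓ : ℕ} {g γ : M2} (hg : g.det = 1) (h : γ ∈ Rconj N ℓ g) :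
    ((phi γ).1 : ℝ) = γ 0 0 + γ 1 1 ∧ (phi γ).2 ∈ Lam N ℓ g := by
  have hd := det_eq hg
  have ht : (g * γ * g⁻¹) 0 0 + (g * γ * g⁻¹) 1 1 = γ 0 0 + γ 1 1 := by
    rw [inv_eq hg]
    simp [Matrix.mul_apply, Fin.sum_univ_two]
    linear_combination (γ 0 0 + γ 1 1) * hd
  obtain ⟨⟨a, ha⟩, ⟨b, hb⟩, ⟨c, hc⟩, ⟨e, he⟩⟩ := h
  have htr : ((phi γ).1 : ℝ) = γ 0 0 + γ 1 1 := by
    have : γ 0 0 + γ 1 1 = ((a + e : ℤ) : ℝ) := by rw [← ht, ha, he]; push_cast; rfl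
    show ((⌊γ 0 0 + γ 1 1⌋ : ℤ) : ℝ) = _
    rw [this, Int.floor_intCast]
  refine ⟨htr, ?_⟩
  have hm : mtV (phi γ).2 = (2:ℝ) • γ - (γ 0 0 + γ 1 1) • (1 : M2) := by
    ext i j
    fin_cases i <;> fin_cases j <;> simp [mtV, phi] <;> ring
  have hgi : g * g⁻¹ = 1 := Matrix.mul_nonsing_inv g (by rw [hg]; exact isUnit_one)
  have hc2 : g * mtV (phi γ).2 * g⁻¹ = (2:ℝ) • (g * γ * g⁻¹) - (γ 0 0 + γ 1 1) • (1 : M2) := by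
    rw [hm, Matrix.mul_sub, Matrix.sub_mul, Matrix.mul_smul, Matrix.smul_mul, Matrix.mul_smul, Matrix.smul_mul,
      Matrix.mul_one, hgi]
  show g * mtV (phi γ).2 * g⁻¹ ∈ Rlat N ℓ
  rw [hc2, ← ht, ha, he]
  refine ⟨⟨a - e, ?_⟩, ⟨2 * b, ?_⟩, ⟨2 * c, ?_⟩, ⟨e - a, ?_⟩⟩
  · simp [Matrix.sub_apply, Matrix.smul_apply, ha]; ring
  · simp only [Matrix.sub_apply, Matrix.smul_apply, hb]; simp; ring
  · simp only [Matrix.sub_apply, Matrix.smul_apply, hc]; simp; ring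
  · simp [Matrix.sub_apply, Matrix.smul_apply, he]; ring

lemma phi_inj {γ γ' : M2} (h1 : ((phi γ).1 : ℝ) = γ 0 0 + γ 1 1) (h2 : ((phi γ').1 : ℝ) = γ' 0 0 + γ' 1 1)
    (h : phi γ = phi γ') : γ = γ' := by
  have ht : γ 0 0 + γ 1 1 = γ' 0 0 + γ' 1 1 := by rw [← h1, ← h2, h]
  have hu : (phi γ).2 = (phi γ').2 := by rw [h]
  have a0 : γ 0 0 - γ 1 1 = γ' 0 0 - γ' 1 1 := congrFun hu 0
  have a1 : γ 0 1 + γ 1 0 = γ' 0 1 + γ' 1 0 := congrFun hu 1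
  have a2 : γ 0 1 - γ 1 0 = γ' 0 1 - γ' 1 0 := congrFun hu 2
  ext i j
  fin_cases i <;> fin_cases j <;> simp <;> linarith

/-- the indefinite form -/
def Qf (u : V3) : ℝ := u 0 ^ 2 + u 1 ^ 2 - u 2 ^ 2

lemma phi_det {γ : M2} (h1 : ((phi γ).1 : ℝ) = γ 0 0 + γ 1 1) :
    4 * γ.det = ((phi γ).1 : ℝ) ^ 2 - Qf (phi γ).2 := by
  rw [h1, Matrix.det_fin_two]
  show _ = _ - ((γ 0 0 - γ 1 1) ^ 2 + (γ 0 1 + γ 1 0) ^ 2 - (γ 0 1 - γ 1 0) ^ 2)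
  ring

lemma phi_box {γ : M2} {d L : ℝ} (hd : 0 < d) (hL : 0 < L) (h1 : ((phi γ).1 : ℝ) = γ 0 0 + γ 1 1)
    (h : γ ∈ PsiSet (d ^ 2) L) :
    |((phi γ).1 : ℝ)| ≤ 2 * (d * L) ∧ |(phi γ).2 0| ≤ 2 * L ∧ |(phi γ).2 1| ≤ 2 * L ∧ |(phi γ).2 2| ≤ d * (2 * L) := by
  obtain ⟨hP, hD⟩ := h
  rw [h1]
  unfold Pfun at hP hD
  rw [Matrix.det_fin_two] at hD
  have hdL : 0 < d * L := by positivity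
  refine ⟨?_, ?_, ?_, ?_⟩
  · apply abs_le_of_sq_le_sq _ (by linarith)
    nlinarith [sq_nonneg (γ 0 1 - γ 1 0)]
  · show |γ 0 0 - γ 1 1| ≤ _
    apply abs_le_of_sq_le_sq _ (by linarith)
    nlinarith [sq_nonneg (γ 0 0 + γ 1 1), sq_nonneg (γ 0 1), sq_nonneg (γ 1 0)]
  · show |γ 0 1 + γ 1 0| ≤ _
    apply abs_le_of_sq_le_sq _ (by linarith)
    nlinarith [sq_nonneg (γ 0 1 - γ 1 0), sq_nonneg (γ 0 0), sq_nonneg (γ 1 1)]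
  · show |γ 0 1 - γ 1 0| ≤ _
    apply abs_le_of_sq_le_sq _ (by nlinarith)
    nlinarith [sq_nonneg (γ 0 0 + γ 1 1)]

/-- traceless lattice points in the box -/
def Ubox (N ℓ : ℕ) (g : M2) (d L : ℝ) : Set V3 :=
  {u | u ∈ Lam N ℓ g ∧ |u 0| ≤ 2 * L ∧ |u 1| ≤ 2 * L ∧ |u 2| ≤ d * (2 * L)}

lemma Ubox_T {ℓ M : ℕ} (hℓ : 0 < ℓ) (hM : 0 < M) (hsq : Squarefree (ℓ * M)) {g : M2} (hg : g.det = 1)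
    {d L : ℝ} (hd : 0 < d) (hd1 : d ≤ 1) (hL : 0 < L) (F : Finset V3) (hF : ∀ u ∈ F, u ∈ Ubox (ℓ * M) ℓ g d L) :
    (F.card : ℝ) ≤ 2400 * (1 + √ℓ * (2 * L) + √ℓ ^ 2 * Hgt (ℓ * M) g * d * (2 * L) + √ℓ ^ 2 * (√M)⁻¹ * (2 * L) ^ 2
      + √ℓ ^ 2 * Hgt (ℓ * M) g * d * (2 * L) ^ 2 + √ℓ ^ 2 * (√M)⁻¹ ^ 2 * d * (2 * L) ^ 3) := by
  have h := T_lem hℓ hM hsq hg F (fun u hu v hv => Lam_sub hg (hF u hu).1 (hF v hv).1) (2 * L) d (by linarith) hd hd1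
    (fun u hu => (hF u hu).2)
  rw [inv_pow, Real.sq_sqrt (Nat.cast_nonneg ℓ), Real.sq_sqrt (Nat.cast_nonneg M)]
  refine h.trans (le_of_eq ?_)
  simp only [div_eq_mul_inv]

lemma Ubox_finite {ℓ M : ℕ} (hℓ : 0 < ℓ) (hM : 0 < M) (hsq : Squarefree (ℓ * M)) {g : M2} (hg : g.det = 1)
    {d L : ℝ} (hd : 0 < d) (hd1 : d ≤ 1) (hL : 0 < L) : (Ubox (ℓ * M) ℓ g d L).Finite := by
  by_contra hinf
  have hinf' : (Ubox (ℓ * M) ℓ g d L).Infinite := hinf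
  obtain ⟨B, hB⟩ : ∃ B : ℝ, ∀ F : Finset V3, (∀ u ∈ F, u ∈ Ubox (ℓ * M) ℓ g d L) → (F.card : ℝ) ≤ B :=
    ⟨_, fun F hF => Ubox_T hℓ hM hsq hg hd hd1 hL F hF⟩
  obtain ⟨n, hn⟩ := exists_nat_gt B
  obtain ⟨F, hF, hc⟩ := hinf'.exists_subset_card_eq n
  have := hB F (fun u hu => hF hu)
  rw [hc] at this
  linarith

lemma Tt_card {B : ℝ} (hB : 0 ≤ B) :
    (((Finset.Icc (-⌊B⌋) ⌊B⌋).filter (fun t : ℤ => t ≠ 0)).card : ℝ) ≤ 2 * B := by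
  have h0 : 0 ≤ ⌊B⌋ := Int.floor_nonneg.2 hB
  have e : (Finset.Icc (-⌊B⌋) ⌊B⌋).filter (fun t : ℤ => t ≠ 0) = (Finset.Icc (-⌊B⌋) ⌊B⌋).erase 0 := by
    ext t; simp [and_comm]
  rw [e, Finset.card_erase_of_mem (by simp [h0]), Int.card_Icc]
  have : (((⌊B⌋ + 1 - -⌊B⌋).toNat - 1 : ℕ) : ℤ) = 2 * ⌊B⌋ := by omega
  have hr : (((⌊B⌋ + 1 - -⌊B⌋).toNat - 1 : ℕ) : ℝ) = 2 * (⌊B⌋ : ℝ) := by exact_mod_cast this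
  rw [hr]
  have := Int.floor_le B
  linarith

set_option maxHeartbeats 1000000 in
lemma nonempty_ineq {ℓ M : ℕ} (hℓ : 0 < ℓ) (hM : 0 < M) (hsq : Squarefree (ℓ * M)) {g : M2} (hg : g.det = 1)
    {d L : ℝ} (hd : 0 < d) (hd1 : d ≤ 1) (hL : 0 < L) {γ : M2} (h : γ ∈ Rconj (ℓ * M) ℓ g ∩ PsiStar (d ^ 2) L) :
    1 ≤ 4 * (√ℓ * L * Xb √ℓ (√M)⁻¹ (Hgt (ℓ * M) g) d L) := by
  have hN : 0 < ℓ * M := Nat.mul_pos hℓ hM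
  have hH := Hgt_pos hN hg
  have hℓr : (1:ℝ) ≤ ℓ := by exact_mod_cast hℓ
  have hMr : (0:ℝ) < M := by exact_mod_cast hM
  have hq : 1 ≤ √(ℓ:ℝ) := Real.one_le_sqrt.2 hℓr
  have hr : 0 < (√(M:ℝ))⁻¹ := by positivity
  have hqq : √(ℓ:ℝ) ^ 2 = ℓ := Real.sq_sqrt (by linarith)
  obtain ⟨x1, x2, x3, x4, x5⟩ := Xb_ge hq hr hH hd hL
  set X := Xb √ℓ (√M)⁻¹ (Hgt (ℓ * M) g) d L
  set q := √(ℓ:ℝ)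
  have hqL : 0 < q * L := by positivity
  obtain ⟨ht, hu⟩ := trace_int hg h.1
  obtain ⟨b0, b1, b2, b3⟩ := phi_box hd hL ht h.2.1
  by_cases hu0 : (phi γ).2 = 0
  · have htn : (phi γ).1 ≠ 0 := by
      intro h0
      apply h.2.2
      apply phi_inj (γ' := 0) ht
      · simp [phi]
      · refine Prod.ext ?_ ?_
        · rw [h0]; simp [phi]
        · rw [hu0]; ext i; fin_cases i <;> simp [phi]
    have := one_le_abs_int htn
    have hL2 : 1 ≤ 2 * L := by nlinarith
    nlinarith [mul_le_mul hq hL2 (by norm_num) (by linarith)]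
  · rcases min_lem hN hsq hℓ (Dvd.intro M rfl) hg hu hu0 with h1 | ⟨_, h1⟩
    · have c0 := sq_le_sq' (abs_le.1 b1).1 (abs_le.1 b1).2
      have c1 := sq_le_sq' (abs_le.1 b2).1 (abs_le.1 b2).2
      have b3' : |(phi γ).2 2| ≤ 2 * L := b3.trans (by nlinarith)
      have c2 := sq_le_sq' (abs_le.1 b3').1 (abs_le.1 b3').2
      have hQ : |(phi γ).2 0 ^ 2 + (phi γ).2 1 ^ 2 - (phi γ).2 2 ^ 2| ≤ 8 * L ^ 2 := by
        rw [abs_le]; constructor <;> nlinarith [sq_nonneg ((phi γ).2 0), sq_nonneg ((phi γ).2 1), sq_nonneg ((phi γ).2 2)]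
      have h2 := h1.trans hQ
      rw [div_le_iff₀ (by linarith), ← hqq] at h2
      have : 1 ≤ 4 * (q * L) := by
        by_contra hc
        push Not at hc
        have h9 : (4 * (q * L)) * (4 * (q * L)) < 1 * 1 := mul_lt_mul'' hc hc (by linarith) (by linarith)
        nlinarith only [h2, h9, sq_nonneg (q * L)]
      have h8 : q * L * 1 ≤ q * L * X := by gcongr
      linarith
    · rw [← hqq] at h1
      have : 2 * q ^ 2 * Hgt (ℓ * M) g * |(phi γ).2 2| ≤ 2 * q ^ 2 * Hgt (ℓ * M) g * (d * (2 * L)) := by gcongr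
      have h3 : q * L * (q * Hgt (ℓ * M) g * d) ≤ q * L * X := by gcongr
      linarith

/-- the set of the statement -/
def Pset (N ℓ : ℕ) (g : M2) (δ L : ℝ) : Set (M2 × M2) :=
  {p : M2 × M2 | p.1 ∈ Rconj N ℓ g ∩ PsiStar δ L ∧ p.2 ∈ Rconj N ℓ g ∩ PsiStar δ L ∧ p.1.det = p.2.det}

set_option maxHeartbeats 1000000 in
lemma main_bound {ℓ M : ℕ} (hℓ : 0 < ℓ) (hM : 0 < M) (hsq : Squarefree (ℓ * M)) {g : M2} (hg : g.det = 1)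
    {d L Dv : ℝ} (hd : 0 < d) (hd1 : d ≤ 1) (hL : 0 < L) (hDv : 1 ≤ Dv)
    (hdiv : ∀ n : ℕ, 0 < n → (n:ℝ) ≤ ℓ * (8 * L ^ 2 + (20 * L ^ 2) ^ 2) → ((Nat.divisors n).card : ℝ) ≤ Dv) :
    (Pset (ℓ * M) ℓ g (d ^ 2) L).Finite ∧ ((Pset (ℓ * M) ℓ g (d ^ 2) L).ncard : ℝ) ≤
      10 ^ 12 * ((Nat.divisors M).card * Dv) * (√ℓ ^ 2 * L ^ 2 * Xb √ℓ (√M)⁻¹ (Hgt (ℓ * M) g) d L ^ 2) := by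
  classical
  have hN : 0 < ℓ * M := Nat.mul_pos hℓ hM
  have hH := Hgt_pos hN hg
  have hℓr : (1:ℝ) ≤ ℓ := by exact_mod_cast hℓ
  have hMr : (1:ℝ) ≤ M := by exact_mod_cast hM
  have hq : 1 ≤ √(ℓ:ℝ) := Real.one_le_sqrt.2 hℓr
  have hp : 1 ≤ √(M:ℝ) := Real.one_le_sqrt.2 hMr
  have hr : 0 < (√(M:ℝ))⁻¹ := by positivity
  have hqq : √(ℓ:ℝ) ^ 2 = ℓ := Real.sq_sqrt (by linarith)
  have hpp : √(M:ℝ) ^ 2 = M := Real.sq_sqrt (by linarith)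
  have hpr : √(M:ℝ) * (√(M:ℝ))⁻¹ = 1 := mul_inv_cancel₀ (by positivity)
  have hD1 : (1:ℝ) ≤ (Nat.divisors M).card := by
    exact_mod_cast Finset.card_pos.2 ⟨1, by simp [hM.ne']⟩
  set S := Pset (ℓ * M) ℓ g (d ^ 2) L with hS
  set U := (Ubox_finite hℓ hM hsq hg hd hd1 hL).toFinset with hU
  have hUm : ∀ u, u ∈ U ↔ u ∈ Ubox (ℓ * M) ℓ g d L := fun u => by rw [hU, Set.Finite.mem_toFinset]
  set B := 2 * (d * L) with hB
  have hB0 : 0 < B := by positivity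
  set Tt := Finset.Icc (-⌊B⌋) ⌊B⌋ with hTt
  set F := ((Tt ×ˢ U) ×ˢ (Tt ×ˢ U)).filter
    (fun p => ((p.1.1 : ℤ) : ℝ) ^ 2 - Qf p.1.2 = ((p.2.1 : ℤ) : ℝ) ^ 2 - Qf p.2.2) with hF
  have hTm : ∀ t : ℤ, |(t:ℝ)| ≤ B → t ∈ Tt := by
    intro t ht
    rw [abs_le] at ht
    rw [hTt, Finset.mem_Icc]
    refine ⟨?_, Int.le_floor.2 ht.2⟩
    have : -t ≤ ⌊B⌋ := Int.le_floor.2 (by push_cast; linarith)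
    linarith
  have hTm' : ∀ t ∈ Tt, |(t:ℝ)| ≤ B := by
    intro t ht
    rw [hTt, Finset.mem_Icc] at ht
    have h2 : (t:ℝ) ≤ B := Int.le_floor.1 ht.2
    have h1 : ((-t : ℤ):ℝ) ≤ B := Int.le_floor.1 (by linarith)
    push_cast at h1
    rw [abs_le]; constructor <;> linarith
  have hone : ∀ γ ∈ Rconj (ℓ * M) ℓ g ∩ PsiStar (d ^ 2) L, ((phi γ).1 : ℝ) = γ 0 0 + γ 1 1 ∧ (phi γ).1 ∈ Tt ∧ (phi γ).2 ∈ U := by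
    intro γ h
    obtain ⟨ht, hu⟩ := trace_int hg h.1
    obtain ⟨b0, b1, b2, b3⟩ := phi_box hd hL ht h.2.1
    exact ⟨ht, hTm _ b0, (hUm _).2 ⟨hu, b1, b2, b3⟩⟩
  have hmaps : Set.MapsTo (fun p : M2 × M2 => (phi p.1, phi p.2)) S (F : Set _) := by
    rintro ⟨γ1, γ2⟩ ⟨h1, h2, h3⟩
    obtain ⟨a1, a2, a3⟩ := hone γ1 h1
    obtain ⟨c1, c2, c3⟩ := hone γ2 h2
    have e1 := phi_det a1
    have e2 := phi_det c1
    have h3' : γ1.det = γ2.det := h3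
    rw [Finset.mem_coe, hF, Finset.mem_filter]
    refine ⟨Finset.mem_product.2 ⟨Finset.mem_product.2 ⟨a2, a3⟩, Finset.mem_product.2 ⟨c2, c3⟩⟩, ?_⟩
    show ((phi γ1).1 : ℝ) ^ 2 - Qf (phi γ1).2 = ((phi γ2).1 : ℝ) ^ 2 - Qf (phi γ2).2
    rw [← e1, ← e2, h3']
  have hinj : Set.InjOn (fun p : M2 × M2 => (phi p.1, phi p.2)) S := by
    rintro ⟨γ1, γ2⟩ ⟨h1, h2, _⟩ ⟨γ3, γ4⟩ ⟨h3, h4, _⟩ he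
    obtain ⟨e1, e2⟩ := Prod.mk.inj he
    exact Prod.ext (phi_inj (hone _ h1).1 (hone _ h3).1 e1) (phi_inj (hone _ h2).1 (hone _ h4).1 e2)
  have hfin : S.Finite := Set.Finite.of_injOn hmaps hinj F.finite_toSet
  refine ⟨hfin, ?_⟩
  have hcard : (S.ncard : ℝ) ≤ F.card := by
    have := Set.ncard_le_ncard_of_injOn _ hmaps hinj F.finite_toSet
    rw [Set.ncard_coe_finset] at this
    exact_mod_cast this
  rcases S.eq_empty_or_nonempty with hSe | ⟨⟨γ0, γ0'⟩, hγ0, _, _⟩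
  · rw [hSe, Set.ncard_empty, Nat.cast_zero]
    positivity
  have h4 := nonempty_ineq hℓ hM hsq hg hd hd1 hL hγ0
  have hT1 := Ubox_T hℓ hM hsq hg hd hd1 hL U (fun u hu => (hUm u).1 hu)
  have hT2 : (U.card : ℝ) ≤ 28800 * (√ℓ * L * Xb √ℓ (√M)⁻¹ (Hgt (ℓ * M) g) d L) := by
    have := T_ineq hq hr hH hd hL h4
    linarith
  have hℓL : 4 * L ^ 2 ≤ ℓ * (8 * L ^ 2 + (20 * L ^ 2) ^ 2) := by nlinarith [sq_nonneg (20 * L ^ 2), sq_nonneg L]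
  have hdivt : ∀ t1 ∈ Tt, ∀ t2 ∈ Tt, t1 ^ 2 - t2 ^ 2 ≠ 0 →
      ((Nat.divisors (t1 ^ 2 - t2 ^ 2).natAbs).card : ℝ) ≤ Dv := by
    intro t1 h1 t2 h2 hne
    apply hdiv _ (Int.natAbs_pos.2 hne)
    refine le_trans ?_ hℓL
    have a1 := sq_le_sq' (abs_le.1 (hTm' t1 h1)).1 (abs_le.1 (hTm' t1 h1)).2
    have a2 := sq_le_sq' (abs_le.1 (hTm' t2 h2)).1 (abs_le.1 (hTm' t2 h2)).2
    have hBB : B ^ 2 ≤ 4 * L ^ 2 := by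
      have : B ≤ 2 * L := by nlinarith
      nlinarith
    rw [Nat.cast_natAbs]
    push_cast
    rw [abs_le]
    constructor <;> nlinarith [sq_nonneg (t1:ℝ), sq_nonneg (t2:ℝ)]
  set X := Xb √ℓ (√M)⁻¹ (Hgt (ℓ * M) g) d L with hX
  set D1 : ℝ := ((Nat.divisors M).card : ℝ) with hD1d
  have hTT : (U.card * U.card : ℝ) ≤ 28800 ^ 2 * (√ℓ ^ 2 * L ^ 2 * X ^ 2) := by
    calc (U.card * U.card : ℝ) ≤ (28800 * (√ℓ * L * X)) * (28800 * (√ℓ * L * X)) := by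
          gcongr
          linarith
      _ = _ := by ring
  have hpos : 0 ≤ √(ℓ:ℝ) ^ 2 * L ^ 2 * X ^ 2 := by positivity
  have h12 : (U.card * U.card : ℝ) * (2 * Dv) + (U.card * U.card : ℝ) ≤
      10 ^ 10 * (D1 * Dv) * (√ℓ ^ 2 * L ^ 2 * X ^ 2) := by
    have hDD : Dv ≤ D1 * Dv := by nlinarith
    calc (U.card * U.card : ℝ) * (2 * Dv) + (U.card * U.card : ℝ) = (U.card * U.card : ℝ) * (2 * Dv + 1) := by ring
      _ ≤ (28800 ^ 2 * (√ℓ ^ 2 * L ^ 2 * X ^ 2)) * (3 * (D1 * Dv)) := by gcongr; linarith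
      _ = (3 * 28800 ^ 2) * (D1 * Dv) * (√ℓ ^ 2 * L ^ 2 * X ^ 2) := by ring
      _ ≤ _ := by gcongr; norm_num
  have hFm : ∀ p ∈ F, p.1.1 ∈ Tt ∧ p.1.2 ∈ U ∧ p.2.1 ∈ Tt ∧ p.2.2 ∈ U ∧
      ((p.1.1 : ℝ)) ^ 2 - Qf p.1.2 = (p.2.1 : ℝ) ^ 2 - Qf p.2.2 := by
    intro p hp
    rw [hF, Finset.mem_filter, Finset.mem_product, Finset.mem_product, Finset.mem_product] at hp
    exact ⟨hp.1.1.1, hp.1.1.2, hp.1.2.1, hp.1.2.2, hp.2⟩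
  have hTc := Tt_card hB0.le
  rw [← hTt] at hTc
  rcases lt_or_ge B 1 with hB1 | hB1
  · have hz : (Tt.filter (fun t : ℤ => t ≠ 0)).card = 0 := by
      rw [Finset.card_eq_zero, Finset.filter_eq_empty_iff]
      intro t ht hne
      have h1 := one_le_abs_int hne
      have h2 := hTm' t ht
      linarith
    have hk := pq_card U Tt Qf U.card Dv (by linarith)
      (fun m => by exact_mod_cast Finset.card_le_card (Finset.filter_subset _ _)) hdivt F hFm
    rw [hz] at hk
    have : 10 ^ 10 * (D1 * Dv) * (√ℓ ^ 2 * L ^ 2 * X ^ 2) ≤ 10 ^ 12 * (D1 * Dv) * (√ℓ ^ 2 * L ^ 2 * X ^ 2) := by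
      gcongr <;> norm_num
    simp only [Nat.cast_zero, zero_mul, add_zero] at hk
    linarith
  · have hLh : 1 / 2 ≤ L := by nlinarith
    have hNH := Hgt_lower hN hsq hg
    obtain ⟨R, hR0, hR, hR1, hR2⟩ : ∃ R : ℝ, 0 ≤ R ∧ (∀ m : ℝ, ((U.filter (fun u => Qf u = m)).card : ℝ) ≤ R) ∧
        (Hgt (ℓ * M) g * L ≤ 1 → R ≤ D1 * (2400 * (1 + 2 * √ℓ * (√M)⁻¹ * L + 2 * √ℓ ^ 2 * Hgt (ℓ * M) g * d * L
          + 4 * √ℓ ^ 2 * (√M)⁻¹ ^ 2 * L ^ 2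
          + 4 * √ℓ ^ 2 * (√M)⁻¹ ^ 2 * Hgt (ℓ * M) g * d * L ^ 2 + 8 * √ℓ ^ 2 * (√M)⁻¹ ^ 4 * d * L ^ 3))) ∧
        (1 ≤ Hgt (ℓ * M) g * L → R ≤ D1 * (128 * Dv * (1 + (√M)⁻¹ ^ 2 * L ^ 2 + √ℓ ^ 2 * Hgt (ℓ * M) g * d * L))) := by
      have hdual : ∀ m : ℝ, ((U.filter (fun u => Qf u = m)).card : ℝ) ≤ D1 * (2400 * (1 + 2 * √ℓ * (√M)⁻¹ * L
          + 2 * √ℓ ^ 2 * Hgt (ℓ * M) g * d * L + 4 * √ℓ ^ 2 * (√M)⁻¹ ^ 2 * L ^ 2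
          + 4 * √ℓ ^ 2 * (√M)⁻¹ ^ 2 * Hgt (ℓ * M) g * d * L ^ 2 + 8 * √ℓ ^ 2 * (√M)⁻¹ ^ 4 * d * L ^ 3)) := by
        intro m
        have := r_dual hℓ hM hsq hg (U.filter (fun u => Qf u = m))
          (fun u hu => ((hUm u).1 (Finset.mem_filter.1 hu).1).1) m (fun u hu => (Finset.mem_filter.1 hu).2) (2 * L) d
          (by linarith) hd hd1 (fun u hu => ((hUm u).1 (Finset.mem_filter.1 hu).1).2)
        refine this.trans (le_of_eq ?_)
        rw [Real.sqrt_mul (by linarith)]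
        have hM' : (M:ℝ) = √(M:ℝ) ^ 2 := hpp.symm
        have hℓ' : (ℓ:ℝ) = √(ℓ:ℝ) ^ 2 := hqq.symm
        have hp0 : √(M:ℝ) ≠ 0 := by positivity
        rw [hqq]
        generalize Hgt (ℓ * M) g = H
        rw [hD1d]
        congr 2
        have i1 : (M:ℝ)⁻¹ = (√(M:ℝ))⁻¹ ^ 2 := by rw [inv_pow, hpp]
        have i2 : (M:ℝ) * (√(M:ℝ))⁻¹ ^ 2 = 1 := by rw [inv_pow, hpp]; exact mul_inv_cancel₀ (by linarith)
        simp only [div_eq_mul_inv, i1]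
        generalize (√(M:ℝ))⁻¹ = r at *
        linear_combination (2 * √(ℓ:ℝ) * L * r) * hpr + (4 * ℓ * r ^ 2 * L ^ 2 + 4 * ℓ * r ^ 2 * H * d * L ^ 2
          + 8 * ℓ * r ^ 4 * d * L ^ 3) * i2
      have hcusp : 1 ≤ Hgt (ℓ * M) g * L → ∀ m : ℝ, ((U.filter (fun u => Qf u = m)).card : ℝ) ≤
          D1 * (128 * Dv * (1 + (√M)⁻¹ ^ 2 * L ^ 2 + √ℓ ^ 2 * Hgt (ℓ * M) g * d * L)) := by
        intro hHL m
        have := r_cusp hℓ hM hsq hg (U.filter (fun u => Qf u = m))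
          (fun u hu => ((hUm u).1 (Finset.mem_filter.1 hu).1).1) m (fun u hu => (Finset.mem_filter.1 hu).2) L d Dv
          hLh hd hd1 hHL hDv hdiv (fun u hu => ((hUm u).1 (Finset.mem_filter.1 hu).1).2)
        refine this.trans (le_of_eq ?_)
        rw [hqq, inv_pow, hpp, div_eq_inv_mul]
      rcases lt_or_ge (Hgt (ℓ * M) g * L) 1 with hc | hc
      · exact ⟨_, by positivity, hdual, fun _ => le_refl _, fun h => absurd hc (not_lt.2 h)⟩
      · by_cases hc1 : Hgt (ℓ * M) g * L ≤ 1
        · refine ⟨min _ _, ?_, fun m => le_min (hdual m) (hcusp hc m), fun _ => min_le_left _ _, fun _ => min_le_right _ _⟩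
          apply le_min <;> positivity
        · exact ⟨_, by positivity, hcusp hc, fun h => absurd h hc1, fun _ => le_refl _⟩
    have hk := pq_card U Tt Qf R Dv (by linarith) hR hdivt F hFm
    have hcB := claimB (q := √ℓ) (p := √M) (r := (√M)⁻¹) (H := Hgt (ℓ * M) g) (d := d) (L := L) (T := U.card) (R := R)
      (D1 := D1) (Dv := Dv) hq hp hpr hH (by rw [hqq, hpp]; push_cast at hNH; exact hNH) hd hd1 hB1
      (Nat.cast_nonneg _) hR0 hT1 hT2 hD1 hDv hR1 hR2
    have h3 : ((Tt.filter (fun t => t ≠ 0)).card * U.card : ℝ) * (2 * R) ≤ 8 * (d * L * U.card * R) := by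
      calc ((Tt.filter (fun t => t ≠ 0)).card * U.card : ℝ) * (2 * R) ≤ (2 * B * U.card) * (2 * R) := by gcongr
        _ = _ := by rw [hB]; ring
    have hP : 0 ≤ (D1 * Dv) * (√(ℓ:ℝ) ^ 2 * L ^ 2 * X ^ 2) := by positivity
    nlinarith

/-- Second-moment count for R(ℓ;g) ∩ Ψ⋆(δ,L). -/
theorem stmt2 (ε : ℝ) (hε : 0 < ε) : ∃ C : ℝ, 0 < C ∧
    ∀ (N ℓ : ℕ) (g : M2) (δ L : ℝ), Squarefree N → 0 < N → 0 < ℓ → ℓ ∣ N →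
    g.det = 1 → 0 < δ → δ ≤ 1 → 0 < L →
    {p : M2 × M2 | p.1 ∈ Rconj N ℓ g ∩ PsiStar δ L ∧
        p.2 ∈ Rconj N ℓ g ∩ PsiStar δ L ∧ p.1.det = p.2.det}.Finite ∧
    (({p : M2 × M2 | p.1 ∈ Rconj N ℓ g ∩ PsiStar δ L ∧
        p.2 ∈ Rconj N ℓ g ∩ PsiStar δ L ∧ p.1.det = p.2.det}.ncard : ℝ) ≤
      C * ((N : ℝ) * (1 + L)) ^ ε * ((ℓ : ℝ) * L ^ 2) *
        (1 + Real.sqrt ℓ * Hgt N g * Real.sqrt δ + (ℓ : ℝ) / Real.sqrt N * L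
          + (ℓ : ℝ) * Hgt N g * Real.sqrt δ * L
          + (ℓ : ℝ) ^ 2 / N * Real.sqrt δ * L ^ 2) ^ 2) := by
  obtain ⟨C0, hC0, hdb⟩ := div_bound (ε / 5) (by linarith)
  have h408 : (0:ℝ) < 408 ^ (ε / 5) := Real.rpow_pos_of_pos (by norm_num) _
  have h408' : (1:ℝ) ≤ 408 ^ (ε / 5) := Real.one_le_rpow (by norm_num) (by linarith)
  refine ⟨10 ^ 12 * (C0 * (C0 * 408 ^ (ε / 5))), by positivity, ?_⟩
  intro N ℓ g δ L hsq hN hℓ hdvd hg hδ hδ1 hL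
  obtain ⟨M, rfl⟩ := hdvd
  have hM : 0 < M := Nat.pos_of_mul_pos_left hN
  have hd : 0 < √δ := Real.sqrt_pos.2 hδ
  have hd1 : √δ ≤ 1 := Real.sqrt_le_one.2 hδ1
  have hdd : √δ ^ 2 = δ := Real.sq_sqrt hδ.le
  have hℓr : (1:ℝ) ≤ ℓ := by exact_mod_cast hℓ
  have hMr : (1:ℝ) ≤ M := by exact_mod_cast hM
  set Z : ℝ := ((ℓ * M : ℕ) : ℝ) * (1 + L) with hZ
  have hNr : ((ℓ * M : ℕ) : ℝ) = ℓ * M := by push_cast; rfl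
  have hℓN : (ℓ:ℝ) ≤ ℓ * M := by nlinarith
  have hMN : (M:ℝ) ≤ ℓ * M := by nlinarith
  have hNL : (ℓ * M : ℝ) ≤ Z := by rw [hZ, hNr]; nlinarith
  have hZ1 : 1 ≤ Z := by linarith
  have hZ0 : 0 < Z := by linarith
  have hdiv : ∀ n : ℕ, 0 < n → (n:ℝ) ≤ ℓ * (8 * L ^ 2 + (20 * L ^ 2) ^ 2) →
      ((Nat.divisors n).card : ℝ) ≤ C0 * 408 ^ (ε / 5) * Z ^ (4 * (ε / 5)) := by
    intro n hn hnl
    have hb : (n:ℝ) ≤ 408 * Z ^ 4 := by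
      refine hnl.trans ?_
      have e1 : L ^ 2 ≤ (1 + L) ^ 4 := by
        calc L ^ 2 ≤ (1 + L) ^ 2 := by gcongr; linarith
          _ ≤ (1 + L) ^ 4 := pow_le_pow_right₀ (by linarith) (by norm_num)
      have e2 : L ^ 4 ≤ (1 + L) ^ 4 := by gcongr; linarith
      have e3 : (ℓ:ℝ) ≤ (ℓ * M : ℝ) ^ 4 :=
        hℓN.trans (le_self_pow₀ (by linarith) (by norm_num))
      calc (ℓ:ℝ) * (8 * L ^ 2 + (20 * L ^ 2) ^ 2) = ℓ * (8 * L ^ 2 + 400 * L ^ 4) := by ring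
        _ ≤ (ℓ * M : ℝ) ^ 4 * (8 * (1 + L) ^ 4 + 400 * (1 + L) ^ 4) := by gcongr
        _ = 408 * Z ^ 4 := by rw [hZ, hNr]; ring
    calc ((Nat.divisors n).card : ℝ) ≤ C0 * (n:ℝ) ^ (ε / 5) := hdb n hn
      _ ≤ C0 * (408 * Z ^ 4) ^ (ε / 5) := by
        gcongr
      _ = C0 * (408 ^ (ε / 5) * Z ^ (4 * (ε / 5))) := by
        rw [Real.mul_rpow (by norm_num) (by positivity), ← Real.rpow_natCast Z 4, ← Real.rpow_mul hZ0.le]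
        norm_num
      _ = _ := by ring
  have hz4 : 1 ≤ Z ^ (4 * (ε / 5)) := Real.one_le_rpow hZ1 (by linarith)
  have hDv : 1 ≤ C0 * 408 ^ (ε / 5) * Z ^ (4 * (ε / 5)) :=
    one_le_mul_of_one_le_of_one_le (one_le_mul_of_one_le_of_one_le hC0 h408') hz4
  obtain ⟨hfin, hcard⟩ := main_bound hℓ hM hsq hg hd hd1 hL hDv hdiv
  rw [hdd] at hfin hcard
  refine ⟨hfin, ?_⟩
  refine le_trans hcard ?_
  have hD1 : ((Nat.divisors M).card : ℝ) ≤ C0 * Z ^ (ε / 5) := by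
    refine (hdb M hM).trans ?_
    gcongr
    linarith
  have hX : Xb √ℓ (√M)⁻¹ (Hgt (ℓ * M) g) √δ L = (1 + Real.sqrt ℓ * Hgt (ℓ * M) g * Real.sqrt δ
      + (ℓ : ℝ) / Real.sqrt ((ℓ * M : ℕ) : ℝ) * L + (ℓ : ℝ) * Hgt (ℓ * M) g * Real.sqrt δ * L
      + (ℓ : ℝ) ^ 2 / ((ℓ * M : ℕ) : ℝ) * Real.sqrt δ * L ^ 2) := by
    have hq0 : √(ℓ:ℝ) ≠ 0 := by positivity
    have hqq : √(ℓ:ℝ) ^ 2 = ℓ := Real.sq_sqrt (by linarith)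
    have hpp : √(M:ℝ) ^ 2 = M := Real.sq_sqrt (by linarith)
    have i1 : (ℓ:ℝ) / Real.sqrt ((ℓ * M : ℕ) : ℝ) = √ℓ * (√M)⁻¹ := by
      rw [hNr, Real.sqrt_mul (by linarith)]
      nth_rewrite 1 [← hqq]
      field_simp
    have i2 : (ℓ:ℝ) ^ 2 / ((ℓ * M : ℕ) : ℝ) = √ℓ ^ 2 * (√M)⁻¹ ^ 2 := by
      rw [hNr, inv_pow, hqq, hpp]
      field_simp
    rw [i1, i2]
    unfold Xb
    rw [hqq]
  rw [hX, Real.sq_sqrt (by linarith : (0:ℝ) ≤ ℓ)]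
  have hZZ : Z ^ (ε / 5) * Z ^ (4 * (ε / 5)) = Z ^ ε := by
    rw [← Real.rpow_add hZ0]; congr 1; ring
  set W := (1 + Real.sqrt ℓ * Hgt (ℓ * M) g * Real.sqrt δ
      + (ℓ : ℝ) / Real.sqrt ((ℓ * M : ℕ) : ℝ) * L + (ℓ : ℝ) * Hgt (ℓ * M) g * Real.sqrt δ * L
      + (ℓ : ℝ) ^ 2 / ((ℓ * M : ℕ) : ℝ) * Real.sqrt δ * L ^ 2)
  calc 10 ^ 12 * ((Nat.divisors M).card * (C0 * 408 ^ (ε / 5) * Z ^ (4 * (ε / 5)))) * (ℓ * L ^ 2 * W ^ 2)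
      ≤ 10 ^ 12 * ((C0 * Z ^ (ε / 5)) * (C0 * 408 ^ (ε / 5) * Z ^ (4 * (ε / 5)))) * (ℓ * L ^ 2 * W ^ 2) := by
        gcongr
    _ = 10 ^ 12 * (C0 * (C0 * 408 ^ (ε / 5))) * (Z ^ (ε / 5) * Z ^ (4 * (ε / 5))) * (ℓ * L ^ 2) * W ^ 2 := by ring
    _ = _ := by rw [hZZ]
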